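/- arXiv:1608.02817 — 3 statements merged into one kernel-verified Lean document; each statement's English description precedes it below -/
import Mathlib

section
/- For all non-negative integers m and n, D_q(m,n) = ∑_{k=0}^{m} q^{(m-k)(n-k)} [m choose k]_q [n choose k]_q (-1;q)_k, as an identity of polynomials in q. -/
open Finset

/-- The q-Pochhammer symbol `(a;q)_n = ∏_{j=0}^{n-1} (1 - a q^j)`. -/
noncomputable def qPoch {F : Type*} [Field F] (q a : F) (n : ℕ) : F :=
  ∏ j ∈ Finset.range n, (1 - a * q ^ j)

/-- The q-binomial coefficient `[n choose k]_q`, which is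
`(q;q)_n / ((q;q)_k (q;q)_{n-k})` for `0 ≤ k ≤ n` and `0` otherwise. -/
noncomputable def qBin {F : Type*} [Field F] (q : F) (n k : ℕ) : F :=
  if k ≤ n then qPoch q q n / (qPoch q q k * qPoch q q (n - k)) else 0

/-- The q-Delannoy number `D_q(m,n) = ∑_{k=0}^n q^{k(k-1)/2} [n,k]_q [n+m-k,n]_q`. -/
noncomputable def Dq {F : Type*} [Field F] (q : F) (m n : ℕ) : F :=
  ∑ k ∈ Finset.range (n + 1), q ^ (k * (k - 1) / 2) * qBin q n k * qBin q (n + m - k) n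

/-- The q-Delannoy number of the second kind
`D*_q(m,n) = ∑_{k=0}^n q^{k(k+1)/2} [n,k]_q [n+m-k,n]_q`. -/
noncomputable def Dstar {F : Type*} [Field F] (q : F) (m n : ℕ) : F :=
  ∑ k ∈ Finset.range (n + 1), q ^ (k * (k + 1) / 2) * qBin q n k * qBin q (n + m - k) n

/-- The field of rational functions `ℚ(q)`. -/
abbrev Fq : Type := FractionRing (Polynomial ℚ)

noncomputable def q : Fq := algebraMap (Polynomial ℚ) Fq Polynomial.X


theorem q_pow_ne (n : ℕ) : (1 : Fq) - q * q ^ n ≠ 0 := by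
  intro h
  have h1 : algebraMap (Polynomial ℚ) Fq (1 - Polynomial.X * Polynomial.X ^ n) = 0 := by
    rw [map_sub, map_mul, map_pow, map_one]; exact h
  have h2 := (IsFractionRing.injective (Polynomial ℚ) Fq) (h1.trans (map_zero _).symm)
  have h3 := congrArg (Polynomial.eval 0) h2
  simp at h3

theorem q_ne : q ≠ 0 := by
  intro h
  have h2 := (IsFractionRing.injective (Polynomial ℚ) Fq) (Eq.trans h (map_zero _).symm)
  exact Polynomial.X_ne_zero h2

theorem P_ne (n : ℕ) : qPoch q q n ≠ 0 := by
  unfold qPoch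
  exact Finset.prod_ne_zero_iff.2 fun j _ => q_pow_ne j

theorem P_succ (a : Fq) (n : ℕ) : qPoch q a (n + 1) = qPoch q a n * (1 - a * q ^ n) := by
  unfold qPoch
  rw [Finset.prod_range_succ]

theorem P_zero (a : Fq) : qPoch q a 0 = 1 := by simp [qPoch]

theorem B_add (k d : ℕ) : qBin q (k + d) k = qPoch q q (k + d) / (qPoch q q k * qPoch q q d) := by
  unfold qBin
  rw [if_pos (by omega), Nat.add_sub_cancel_left]

theorem B_lt {n k : ℕ} (h : n < k) : qBin q n k = 0 := by
  unfold qBin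
  rw [if_neg (by omega)]

theorem B_zero (n : ℕ) : qBin q n 0 = 1 := by
  have := B_add 0 n
  rw [Nat.zero_add] at this
  rw [this, P_zero, one_mul, div_self (P_ne n)]

theorem B_self (n : ℕ) : qBin q n n = 1 := by
  have := B_add n 0
  rw [Nat.add_zero] at this
  rw [this, P_zero, mul_one, div_self (P_ne n)]

theorem B_pascal (n k : ℕ) :
    qBin q (n + 1) (k + 1) = q ^ (n - k) * qBin q n k + qBin q n (k + 1) := by
  rcases lt_trichotomy n k with h | h | h
  · rw [B_lt (by omega), B_lt h, B_lt (by omega)]; ring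
  · subst h
    rw [B_self, B_self, B_lt (by omega)]; simp
  · obtain ⟨d, rfl⟩ : ∃ d, n = k + 1 + d := ⟨n - k - 1, by omega⟩
    have e1 : qBin q (k + 1 + d + 1) (k + 1) = _ := B_add (k + 1) (d + 1)
    have e2 : qBin q (k + 1 + d) k = qPoch q q (k + 1 + d) / (qPoch q q k * qPoch q q (d + 1)) := by
      have := B_add k (d + 1)
      rwa [show k + (d + 1) = k + 1 + d by omega] at this
    rw [e1, e2, B_add (k + 1) d, show k + 1 + d - k = d + 1 by omega,
      show k + 1 + (d + 1) = (k + 1 + d) + 1 by omega, P_succ q (k + 1 + d), P_succ q k, P_succ q d]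
    have h1 := P_ne k
    have h2 := P_ne d
    have h3 := q_pow_ne k
    have h4 := q_pow_ne d
    field_simp
    ring

theorem B_tri {n k : ℕ} (j : ℕ) (hk : k ≤ n) (hj : j ≤ n) :
    qBin q n k * qBin q k j = qBin q n j * qBin q (n - j) (n - k) := by
  rcases lt_or_ge k j with h | h
  · rw [B_lt h, B_lt (show n - j < n - k by omega)]; ring
  · obtain ⟨a, rfl⟩ := Nat.exists_eq_add_of_le h
    obtain ⟨b, rfl⟩ := Nat.exists_eq_add_of_le hk
    have e1 : qBin q (j + a + b) j = qPoch q q (j + (a + b)) / (qPoch q q j * qPoch q q (a + b)) := by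
      rw [Nat.add_assoc]; exact B_add j (a + b)
    rw [e1, B_add, B_add, show j + a + b - j = b + a by omega, show j + a + b - (j + a) = b by omega,
      B_add, ← Nat.add_assoc, Nat.add_comm b a]
    have h1 := P_ne j
    have h2 := P_ne a
    have h3 := P_ne b
    have h4 := P_ne (a + b)
    have h5 := P_ne (j + a)
    field_simp

theorem tri_succ (j : ℕ) : (j + 1) * (j + 1 - 1) / 2 = j * (j - 1) / 2 + j := by
  have := Nat.choose_two_right (j + 1)
  rw [← this, ← Nat.choose_two_right, Nat.choose_succ_succ' j 1]
  simp [Nat.add_comm]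

theorem q_binom (k : ℕ) :
    qPoch q (-1) k = ∑ j ∈ range (k + 1), q ^ (j * (j - 1) / 2) * qBin q k j := by
  induction k with
  | zero => simp [P_zero, B_zero]
  | succ k ih =>
    have e : ∀ j ∈ range (k + 1), q ^ ((j + 1) * (j + 1 - 1) / 2) * qBin q (k + 1) (j + 1)
        = q ^ k * (q ^ (j * (j - 1) / 2) * qBin q k j)
          + q ^ ((j + 1) * (j + 1 - 1) / 2) * qBin q k (j + 1) := by
      intro j hj
      have hj' : j ≤ k := by simpa [Nat.lt_succ_iff] using hj
      rw [B_pascal, tri_succ]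
      obtain ⟨d, rfl⟩ := Nat.exists_eq_add_of_le hj'
      rw [Nat.add_sub_cancel_left]
      ring
    have e2 : ∑ j ∈ range (k + 1 + 1), q ^ (j * (j - 1) / 2) * qBin q k j = qPoch q (-1) k := by
      rw [sum_range_succ, ← ih, B_lt (by omega)]; ring
    rw [sum_range_succ', B_zero] at e2
    rw [sum_range_succ', sum_congr rfl e, sum_add_distrib, ← mul_sum, ← ih, P_succ, B_zero, add_assoc, e2]
    ring

theorem q_vand (M N r : ℕ) :
    qBin q (M + N) r = ∑ k ∈ range (r + 1), q ^ ((M - k) * (r - k)) * qBin q M k * qBin q N (r - k) := by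
  induction N generalizing r with
  | zero =>
    rw [sum_range_succ, sum_eq_zero]
    · simp [B_zero]
    · intro k hk
      rw [mem_range] at hk
      rw [B_lt (show 0 < r - k by omega), mul_zero]
  | succ N ih =>
    cases r with
    | zero => simp [B_zero]
    | succ r =>
      rw [← Nat.add_assoc, B_pascal, ih r, ih (r + 1), sum_range_succ _ (r + 1), sum_range_succ _ (r + 1),
        mul_sum, ← add_assoc, ← sum_add_distrib]
      congr 1
      · apply sum_congr rfl
        intro k hk
        have hk' : k ≤ r := by simpa [Nat.lt_succ_iff] using hk
        rw [show r + 1 - k = (r - k) + 1 by omega, B_pascal]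
        rcases lt_or_ge M k with h | h
        · rw [B_lt h]; ring
        rcases lt_or_ge N (r - k) with h' | h'
        · rw [B_lt h']; ring
        have : M + N - r = (M - k) + (N - (r - k)) := by omega
        rw [this]
        ring
      · simp [B_zero]

theorem Dq_eq (m n : ℕ) :
    Dq q m n = ∑ k ∈ Finset.range (m + 1),
      q ^ (((m : ℤ) - k) * ((n : ℤ) - k)) * qBin q m k * qBin q n k * qPoch q (-1) k := by
  have hR : ∑ k ∈ Finset.range (m + 1),
      q ^ (((m : ℤ) - k) * ((n : ℤ) - k)) * qBin q m k * qBin q n k * qPoch q (-1) k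
      = ∑ k ∈ Finset.range (n + 1), ∑ j ∈ range (n + 1), q ^ (j * (j - 1) / 2) * qBin q n j *
        (q ^ ((m - k) * (n - k)) * qBin q m k * qBin q (n - j) (n - k)) := by
    have a1 : ∑ k ∈ Finset.range (m + 1),
      q ^ (((m : ℤ) - k) * ((n : ℤ) - k)) * qBin q m k * qBin q n k * qPoch q (-1) k
      = ∑ k ∈ Finset.range (m + n + 1),
      q ^ (((m : ℤ) - k) * ((n : ℤ) - k)) * qBin q m k * qBin q n k * qPoch q (-1) k := by
      apply sum_subset
      · intro k; simp only [mem_range]; omega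
      · intro k _ hk
        rw [mem_range] at hk
        rw [B_lt (show m < k by omega)]; ring
    have a2 : ∑ k ∈ Finset.range (n + 1),
      q ^ (((m : ℤ) - k) * ((n : ℤ) - k)) * qBin q m k * qBin q n k * qPoch q (-1) k
      = ∑ k ∈ Finset.range (m + n + 1),
      q ^ (((m : ℤ) - k) * ((n : ℤ) - k)) * qBin q m k * qBin q n k * qPoch q (-1) k := by
      apply sum_subset
      · intro k; simp only [mem_range]; omega
      · intro k _ hk
        rw [mem_range] at hk
        rw [B_lt (show n < k by omega)]; ring
    rw [a1, ← a2]
    apply sum_congr rfl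
    intro k hk
    have hkn : k ≤ n := by simpa [Nat.lt_succ_iff] using hk
    rcases lt_or_ge m k with h | h
    · rw [B_lt h]; simp
    have a3 : qPoch q (-1) k = ∑ j ∈ range (n + 1), q ^ (j * (j - 1) / 2) * qBin q k j := by
      rw [q_binom]
      apply sum_subset
      · intro k; simp only [mem_range]; omega
      · intro j _ hj
        rw [mem_range] at hj
        rw [B_lt (show k < j by omega)]; ring
    have a4 : q ^ (((m : ℤ) - k) * ((n : ℤ) - k)) = q ^ ((m - k) * (n - k)) := by
      rw [← Nat.cast_sub h, ← Nat.cast_sub hkn, ← Nat.cast_mul, zpow_natCast]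
    rw [a3, a4, mul_sum]
    apply sum_congr rfl
    intro j hj
    have hjn : j ≤ n := by simpa [Nat.lt_succ_iff] using hj
    have := B_tri j hkn hjn
    linear_combination (q ^ ((m - k) * (n - k)) * qBin q m k * q ^ (j * (j - 1) / 2)) * this
  rw [hR, sum_comm]
  unfold Dq
  apply sum_congr rfl
  intro j hj
  have hjn : j ≤ n := by simpa [Nat.lt_succ_iff] using hj
  rw [← mul_sum, ← q_vand, show n + m - j = m + (n - j) by omega]
end

section
/- For all non-negative integers m and n, D_q(m,n) · D*_q(m,n) = ∑_{k=0}^{n} q^{(m-k)(n-k)} [n+k choose 2k]_q [m choose k]_q [m+k choose k]_q (-1;q)_k (-q;q)_k, as an identity of polynomials in q. -/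
open Finset

namespace QD
variable {F : Type*} [Field F]

lemma qPoch_succ (q a : F) (n : ℕ) : qPoch q a (n+1) = qPoch q a n * (1 - a * q^n) := by
  simp [qPoch, Finset.prod_range_succ]

lemma qPoch_succ' (q a : F) (n : ℕ) : qPoch q a (n+1) = (1 - a) * qPoch q (a*q) n := by
  simp only [qPoch, Finset.prod_range_succ']
  rw [mul_comm]
  congr 1
  · simp
  · apply Finset.prod_congr rfl; intros; ring

lemma qPoch_zero (q a : F) : qPoch q a 0 = 1 := by simp [qPoch]

lemma qPoch_ne (q : F) (hq : ∀ k : ℕ, q^(k+1) ≠ 1) (n : ℕ) : qPoch q q n ≠ 0 := by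
  rw [qPoch, Finset.prod_ne_zero_iff]
  intro j _ h
  apply hq j
  rw [pow_succ']; linear_combination -h

lemma qPoch_add (q a : F) (m n : ℕ) : qPoch q a (m+n) = qPoch q a m * qPoch q (a*q^m) n := by
  simp only [qPoch, Finset.prod_range_add]
  congr 1
  apply Finset.prod_congr rfl; intros; ring

/-- complete-type coefficient -/
noncomputable def hh (q : F) (n m k : ℕ) : F := qBin q (n + m - k) n
noncomputable def ee (q : F) (n k : ℕ) : F := q ^ (k * (k - 1) / 2) * qBin q n k

lemma tri (k : ℕ) : (k+1) * (k+1-1) / 2 = k*(k-1)/2 + k := by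
  have := Nat.triangle_succ k
  rw [this]

lemma tri' (k : ℕ) : k * (k+1) / 2 = k*(k-1)/2 + k := by
  rw [← tri k, Nat.add_sub_cancel, Nat.mul_comm]

lemma ee_succ (q : F) (hq : ∀ k : ℕ, q^(k+1) ≠ 1) (n k : ℕ) :
    (1 - q^(k+1)) * ee q n (k+1) = (q^k - q^n) * ee q n k := by
  unfold ee qBin
  rw [tri]
  rcases lt_trichotomy k n with h | h | h
  · obtain ⟨d, rfl⟩ : ∃ d, n = k + 1 + d := ⟨n - (k+1), by omega⟩
    rw [if_pos (by omega), if_pos (by omega)]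
    rw [show k + 1 + d - (k+1) = d by omega, show k + 1 + d - k = d + 1 by omega]
    have h1 := qPoch_ne q hq k
    have h2 := qPoch_ne q hq d
    have h3 : 1 - q * q^k ≠ 0 := by
      intro h; apply hq k; rw [pow_succ']; linear_combination -h
    have h4 : 1 - q * q^d ≠ 0 := by
      intro h; apply hq d; rw [pow_succ']; linear_combination -h
    rw [qPoch_succ q q k, qPoch_succ q q d]
    have e : q ^ (k*(k-1)/2 + k) = q ^ (k*(k-1)/2) * q^k := pow_add _ _ _
    rw [e]
    generalize qPoch q q (k+1+d) = X
    generalize q ^ (k*(k-1)/2) = Y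
    simp only [pow_add, pow_one]
    generalize q ^ k = K at *
    generalize q ^ d = D at *
    have h3' : 1 - K * q ≠ 0 := by rwa [mul_comm]
    have h4' : 1 - D * q ≠ 0 := by rwa [mul_comm]
    field_simp
    try ring
  · subst h
    simp
  · rw [if_neg (by omega), if_neg (by omega)]; simp

lemma hh_zero (q : F) (n m k : ℕ) (h : m < k) (hk : k ≤ n) : hh q n m k = 0 := by
  unfold hh qBin
  rw [if_neg (by omega)]

lemma hh_succ_succ (q : F) (n m k : ℕ) : hh q n (m+1) (k+1) = hh q n m k := by
  unfold hh
  congr 1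
  omega

lemma hh_succ (q : F) (hq : ∀ k : ℕ, q^(k+1) ≠ 1) (n m k : ℕ) (hk : k ≤ n) :
    (q^k - q^(m+1)) * hh q n (m+1) k = (q^k - q^(m+1) * q^n) * hh q n m k := by
  rcases lt_trichotomy k (m+1) with h | h | h
  · obtain ⟨d, rfl⟩ : ∃ d, m = k + d := ⟨m - k, by omega⟩
    unfold hh qBin
    rw [if_pos (by omega), if_pos (by omega)]
    rw [show n + (k + d + 1) - k = n + d + 1 by omega, show n + (k+d) - k = n + d by omega,
      show n + d + 1 - n = d + 1 by omega, show n + d - n = d by omega]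
    have h1 := qPoch_ne q hq n
    have h2 := qPoch_ne q hq d
    have h4 : 1 - q * q^d ≠ 0 := by
      intro h; apply hq d; rw [pow_succ']; linear_combination -h
    rw [qPoch_succ, qPoch_succ q q d]
    simp only [pow_add, pow_one]
    generalize q ^ d = D at *
    have h4' : 1 - D * q ≠ 0 := by rwa [mul_comm]
    field_simp
    try ring
  · subst h
    rw [hh_zero q n m (m+1) (by omega) hk]; ring
  · rw [hh_zero q n m k (by omega) hk, hh_zero q n (m+1) k (by omega) hk]; ring

lemma Dq_eq (q : F) (m n : ℕ) : Dq q m n = ∑ k ∈ range (n+1), ee q n k * hh q n m k := rfl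

lemma Dstar_eq (q : F) (m n : ℕ) :
    Dstar q m n = ∑ k ∈ range (n+1), q^k * (ee q n k * hh q n m k) := by
  unfold Dstar ee hh
  apply Finset.sum_congr rfl
  intro k _
  rw [tri', pow_add]; ring

lemma R2 (q : F) (hq : ∀ k : ℕ, q^(k+1) ≠ 1) (m n : ℕ) :
    Dstar q (m+1) n - Dstar q m n = q^(m+1) * (Dq q (m+1) n - q^n * Dq q m n) := by
  rw [Dq_eq, Dq_eq, Dstar_eq, Dstar_eq, Finset.mul_sum, ← Finset.sum_sub_distrib,
    ← Finset.sum_sub_distrib, Finset.mul_sum]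
  apply Finset.sum_congr rfl
  intro k hk
  have := hh_succ q hq n m k (by simp at hk; omega)
  linear_combination ee q n k * this

lemma R1 (q : F) (hq : ∀ k : ℕ, q^(k+1) ≠ 1) (m n : ℕ) :
    Dstar q (m+1) n + Dstar q m n = Dq q (m+1) n + q^n * Dq q m n := by
  have key : ∑ k ∈ range (n+1), (1 - q^k) * (ee q n k * hh q n (m+1) k)
      = ∑ k ∈ range (n+1), (q^k - q^n) * (ee q n k * hh q n m k) := by
    rw [Finset.sum_range_succ', Finset.sum_range_succ]
    simp only [pow_zero, sub_self, zero_mul, add_zero]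
    apply Finset.sum_congr rfl
    intro k _
    rw [hh_succ_succ]
    linear_combination hh q n m k * ee_succ q hq n k
  simp only [sub_mul, one_mul, Finset.sum_sub_distrib, ← Finset.mul_sum] at key
  rw [Dq_eq, Dq_eq, Dstar_eq, Dstar_eq]
  linear_combination -key

lemma Dq_zero (q : F) (hq : ∀ k : ℕ, q^(k+1) ≠ 1) (n : ℕ) : Dq q 0 n = 1 ∧ Dstar q 0 n = 1 := by
  have h0 : ee q n 0 * hh q n 0 0 = 1 := by
    have := qPoch_ne q hq n
    simp [ee, hh, qBin, qPoch_zero, this]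
  constructor
  · rw [Dq_eq, Finset.sum_eq_single 0]
    · exact h0
    · intro k hk h; rw [hh_zero q n 0 k (by omega) (by simp at hk; omega)]; ring
    · simp
  · rw [Dstar_eq, Finset.sum_eq_single 0]
    · rw [h0]; simp
    · intro k hk h; rw [hh_zero q n 0 k (by omega) (by simp at hk; omega)]; ring
    · simp

noncomputable def psi (q : F) (k : ℕ) (x : F) : F :=
  ∏ j ∈ range k, (x⁻¹ + q * x - (q^(j+1) + (q^j)⁻¹))

noncomputable def cc (q : F) (k : ℕ) : F :=
  q^(k^2) * qPoch q (-1) k * qPoch q (-q) k / (qPoch q q (2*k) * qPoch q q k ^ 2)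

lemma psi_zero (q x : F) : psi q 0 x = 1 := by simp [psi]

lemma psi_succ (q x : F) (k : ℕ) :
    psi q (k+1) x = psi q k x * (x⁻¹ + q * x - (q^(k+1) + (q^k)⁻¹)) := by
  simp [psi, Finset.prod_range_succ]

lemma psi_vanish (q : F) (k m : ℕ) (h : m < k) : psi q k (q^m) = 0 := by
  apply Finset.prod_eq_zero (mem_range.mpr h)
  ring

lemma psi_poch (q x : F) (h0 : q ≠ 0) (hx : x ≠ 0) (k : ℕ) :
    psi q k x = (x^k)⁻¹ * qPoch q (x * q / q^k) (2*k) := by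
  induction k with
  | zero => simp [psi_zero, qPoch_zero]
  | succ k ih =>
    rw [psi_succ, ih, show 2 * (k+1) = (2*k+1)+1 by ring, qPoch_succ', qPoch_succ]
    have e : x * q / q^(k+1) * q = x * q / q^k := by rw [pow_succ]; field_simp
    rw [e]
    have hk : q^k ≠ 0 := pow_ne_zero _ h0
    generalize qPoch q (x * q / q^k) (2*k) = X
    rw [show 2 * k = k + k by ring]
    simp only [pow_add, pow_one]
    generalize q ^ k = K at *
    field_simp
    ring

lemma one_sub_ne (q : F) (hq : ∀ k : ℕ, q^(k+1) ≠ 1) (k : ℕ) : 1 - q^k * q ≠ 0 := by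
  intro h; apply hq k; rw [pow_succ]; linear_combination -h

lemma one_add_ne (q : F) (hq : ∀ k : ℕ, q^(k+1) ≠ 1) (k : ℕ) : 1 + q^k * q ≠ 0 := by
  intro h; apply hq (2*k+1)
  rw [show 2*k+1+1 = (k+1)*2 by ring, pow_mul, pow_succ]
  linear_combination (q^k * q - 1) * h

lemma cc_succ (q : F) (hq : ∀ k : ℕ, q^(k+1) ≠ 1) (k : ℕ) :
    cc q (k+1) * ((1 - q^k * q^k * q) * (1 - q^k * q)^3) = cc q k * (q * q^k * q^k * (1 + q^k)) := by
  unfold cc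
  rw [show 2 * (k+1) = (2*k+1)+1 by ring]
  simp only [qPoch_succ]
  have h1 := qPoch_ne q hq k
  have h2 := qPoch_ne q hq (2*k)
  have h3 := one_sub_ne q hq k
  have h3' := one_add_ne q hq k
  have h4 := one_sub_ne q hq (2*k)
  rw [show q^((k+1)^2) = q^(k^2) * q^k * q^k * q by ring]
  rw [show q^(2*k+1) = q^k * q^k * q by ring]
  rw [show q^(2*k) = q^k * q^k by ring] at *
  generalize q ^ k = K at *
  have h5 : 1 - q * (K * K * q) ≠ 0 := by
    have := mul_ne_zero h3 h3'
    intro h; apply this; linear_combination h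
  have h6 : 1 - q * (K * K) ≠ 0 := by rwa [mul_comm q]
  have h7 : 1 - q * K ≠ 0 := by rwa [mul_comm q]
  rw [div_mul_eq_mul_div, div_mul_eq_mul_div, div_eq_div_iff (by simp [*]) (by simp [*])]
  ring

noncomputable def uu (x p0 p1 : F) : F := 2 / (1 + x) * (p1 - p0)
noncomputable def ww (x p0 p1 : F) : F := (1 + x) * p0 + (1 - x)^2 / 4 * uu x p0 p1
noncomputable def yy (q x p1 p2 : F) : F := ww (q*x) p1 p2 + q * x * uu (q*x) p1 p2
noncomputable def vv (q x p0 p1 p2 p3 : F) : F :=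
  ww (q^2*x) p2 p3 + q * ww x p0 p1 + 2 * q * x * uu x p0 p1

lemma core0 (q x : F) : vv q x 1 1 1 1 - (q + 1) * yy q x 1 1 = 0 := by
  simp [vv, yy, ww, uu]; ring

lemma core1 (q x : F) (h2 : (2:F) ≠ 0) (h0 : q ≠ 0) (hx : x ≠ 0) (hq : ∀ k : ℕ, q^(k+1) ≠ 1)
    (hx1 : 1 + x ≠ 0) (hx2 : 1 + q * x ≠ 0) (hx3 : 1 + q^2 * x ≠ 0) :
    cc q 1 * (vv q x (psi q 1 (x/q)) (psi q 1 x) (psi q 1 (q*x)) (psi q 1 (q^2*x))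
      - (q^2 + (q^1)⁻¹) * yy q x (psi q 1 x) (psi q 1 (q*x))) = cc q 0 * yy q x 1 1 := by
  have h := cc_succ q hq 0
  have h3 := one_sub_ne q hq 0
  simp only [pow_zero, one_mul, zero_add] at h h3
  have e : cc q 1 = cc q 0 * (2 * q) / (1 - q)^4 := by
    rw [eq_div_iff (by simp [h3])]; linear_combination h
  rw [e]
  simp only [psi_succ, psi_zero, vv, yy, ww, uu]
  have h4 : (4:F) ≠ 0 := by
    rw [show (4:F) = 2 * 2 by norm_num]; exact mul_ne_zero h2 h2
  field_simp
  ring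

lemma core2 (q x : F) (h2 : (2:F) ≠ 0) (h0 : q ≠ 0) (hx : x ≠ 0) (hq : ∀ k : ℕ, q^(k+1) ≠ 1)
    (hx1 : 1 + x ≠ 0) (hx2 : 1 + q * x ≠ 0) (hx3 : 1 + q^2 * x ≠ 0) (l : ℕ) :
    cc q (l+2) * (vv q x (psi q (l+2) (x/q)) (psi q (l+2) x) (psi q (l+2) (q*x)) (psi q (l+2) (q^2*x))
      - (q^(l+3) + (q^(l+2))⁻¹) * yy q x (psi q (l+2) x) (psi q (l+2) (q*x)))
      = cc q (l+1) * yy q x (psi q (l+1) x) (psi q (l+1) (q*x)) := by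
  have h := cc_succ q hq (l+1)
  have h3 := one_sub_ne q hq (l+1)
  have h5 := one_sub_ne q hq (2*(l+1))
  have hl : q^l ≠ 0 := pow_ne_zero _ h0
  have hxl : x^l ≠ 0 := pow_ne_zero _ hx
  have h4 : (4:F) ≠ 0 := by
    rw [show (4:F) = 2 * 2 by norm_num]; exact mul_ne_zero h2 h2
  obtain ⟨Z, hZ⟩ : ∃ Z, Z = qPoch q (x * q / q^l) (2*l+1) := ⟨_, rfl⟩
  have p0 : psi q (l+2) (x/q) = (x^l*x^2)⁻¹ * (q^l*q^2) * ((1 - x / (q^l*q^2)) * (1 - x / (q^l*q)) * (1 - x / q^l) * Z) := by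
    rw [psi_poch q _ h0 (by simp [*]), show 2*(l+2) = ((2*l+1)+1+1)+1 by ring, qPoch_succ', qPoch_succ', qPoch_succ']
    rw [hZ]
    have e : ((x / q)^(l+2))⁻¹ = (x^l*x^2)⁻¹ * (q^l*q^2) := by
      rw [div_pow, pow_add, pow_add]; field_simp
    have e0 : x / q * q / q^(l+2) = x / (q^l*q^2) := by rw [pow_add]; field_simp
    have e1 : x / (q^l*q^2) * q = x / (q^l*q) := by field_simp
    have e2 : x / (q^l*q) * q = x / (q^l) := by field_simp
    have e3 : x / (q^l) * q = x * q / (q^l) := by field_simp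
    rw [e, e0, e1, e2, e3]; ring
  have p1 : psi q (l+2) x = (x^l*x^2)⁻¹ * ((1 - x / (q^l*q)) * (1 - x / q^l) * Z * (1 - x * q^2 * q^l)) := by
    rw [psi_poch q _ h0 hx, show 2*(l+2) = ((2*l+1)+1+1)+1 by ring, qPoch_succ', qPoch_succ', qPoch_succ]
    rw [hZ]
    have e0 : x * q / q^(l+2) = x / (q^l*q) := by rw [pow_add]; field_simp
    have e2 : x / (q^l*q) * q = x / (q^l) := by field_simp
    have e3 : x / (q^l) * q = x * q / (q^l) := by field_simp
    have e4 : x * q / q^l * q^(2*l+1) = x * q^2 * q^l := by rw [show 2*l+1 = l+l+1 by ring, pow_add, pow_add]; field_simp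
    rw [e0, e2, e3, e4]; ring
  have p2 : psi q (l+2) (q*x) = (x^l*x^2)⁻¹ * (q^l*q^2)⁻¹ * ((1 - x / q^l) * Z * (1 - x * q^2 * q^l) * (1 - x * q^3 * q^l)) := by
    rw [psi_poch q _ h0 (by simp [*]), show 2*(l+2) = ((2*l+1)+1+1)+1 by ring, qPoch_succ', qPoch_succ, qPoch_succ]
    rw [hZ]
    have e : ((q*x)^(l+2))⁻¹ = (x^l*x^2)⁻¹ * (q^l*q^2)⁻¹ := by
      rw [mul_pow, pow_add, pow_add]; field_simp
    have e0 : q * x * q / q^(l+2) = x / (q^l) := by rw [pow_add]; field_simp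
    have e3 : x / (q^l) * q = x * q / (q^l) := by field_simp
    have e4 : x * q / q^l * q^(2*l+1) = x * q^2 * q^l := by rw [show 2*l+1 = l+l+1 by ring, pow_add, pow_add]; field_simp
    have e5 : x * q / q^l * q^(2*l+1+1) = x * q^3 * q^l := by rw [show 2*l+1+1 = l+l+2 by ring, pow_add, pow_add]; field_simp
    rw [e, e0, e3, e4, e5]; ring
  have p3 : psi q (l+2) (q^2*x) = (x^l*x^2)⁻¹ * ((q^l*q^2)⁻¹)^2 * (Z * (1 - x * q^2 * q^l) * (1 - x * q^3 * q^l) * (1 - x * q^4 * q^l)) := by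
    rw [psi_poch q _ h0 (by simp [*]), show 2*(l+2) = ((2*l+1)+1+1)+1 by ring, qPoch_succ, qPoch_succ, qPoch_succ]
    rw [hZ]
    have e : ((q^2*x)^(l+2))⁻¹ = (x^l*x^2)⁻¹ * ((q^l*q^2)⁻¹)^2 := by
      rw [mul_pow, ← pow_mul, show 2*(l+2) = (l+2)*2 by ring, pow_mul, pow_add, pow_add]; field_simp
    have e3 : q^2 * x * q / q^(l+2) = x * q / (q^l) := by rw [pow_add]; field_simp
    have e4 : x * q / q^l * q^(2*l+1) = x * q^2 * q^l := by rw [show 2*l+1 = l+l+1 by ring, pow_add, pow_add]; field_simp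
    have e5 : x * q / q^l * q^(2*l+1+1) = x * q^3 * q^l := by rw [show 2*l+1+1 = l+l+2 by ring, pow_add, pow_add]; field_simp
    have e6 : x * q / q^l * q^(2*l+1+1+1) = x * q^4 * q^l := by rw [show 2*l+1+1+1 = l+l+3 by ring, pow_add, pow_add]; field_simp
    rw [e, e3, e4, e5, e6]
  have r1 : psi q (l+1) x = (x^l*x)⁻¹ * ((1 - x / q^l) * Z) := by
    rw [psi_poch q _ h0 hx, show 2*(l+1) = (2*l+1)+1 by ring, qPoch_succ']
    rw [hZ]
    have e0 : x * q / q^(l+1) = x / (q^l) := by rw [pow_add]; field_simp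
    have e3 : x / (q^l) * q = x * q / (q^l) := by field_simp
    rw [e0, e3]; ring
  have r2 : psi q (l+1) (q*x) = (x^l*x)⁻¹ * (q^l*q)⁻¹ * (Z * (1 - x * q^2 * q^l)) := by
    rw [psi_poch q _ h0 (by simp [*]), show 2*(l+1) = (2*l+1)+1 by ring, qPoch_succ]
    rw [hZ]
    have e : ((q*x)^(l+1))⁻¹ = (x^l*x)⁻¹ * (q^l*q)⁻¹ := by
      rw [mul_pow, pow_add, pow_add]; field_simp
    have e0 : q * x * q / q^(l+1) = x * q / (q^l) := by rw [pow_add]; field_simp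
    have e4 : x * q / q^l * q^(2*l+1) = x * q^2 * q^l := by rw [show 2*l+1 = l+l+1 by ring, pow_add, pow_add]; field_simp
    rw [e, e0, e4]
  rw [p0, p1, p2, p3, r1, r2]
  clear p0 p1 p2 p3 r1 r2 hZ
  rw [show q^(2*(l+1)) * q = q^l * q^l * q^3 by ring] at h5
  rw [show q^(l+1) * q = q^l * q^2 by ring] at h3
  have e : cc q (l+2) = cc q (l+1) * (q * (q^l*q)^2 * (1 + q^l*q)) / ((1 - q^l*q^l*q^3) * (1 - q^l*q^2)^3) := by
    rw [eq_div_iff (by simp [h3, h5])]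
    linear_combination h
  rw [e]
  clear h e
  simp only [vv, yy, ww, uu]
  rw [pow_add q l 3, pow_add q l 2]
  generalize x^l = X at *
  generalize q^l = L at *
  generalize cc q (l+1) = C
  have h5' : 1 - L^2*q^3 ≠ 0 := by rwa [pow_two]
  have h5'' : 1 - q^3*L^2 ≠ 0 := by rwa [mul_comm]
  have h3' : 1 - q^2*L ≠ 0 := by rwa [mul_comm]
  field_simp
  ring

lemma core (q x : F) (h2 : (2:F) ≠ 0) (h0 : q ≠ 0) (hx : x ≠ 0) (hq : ∀ k : ℕ, q^(k+1) ≠ 1)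
    (hx1 : 1 + x ≠ 0) (hx2 : 1 + q * x ≠ 0) (hx3 : 1 + q^2 * x ≠ 0) (k : ℕ) :
    cc q (k+1) * (vv q x (psi q (k+1) (x/q)) (psi q (k+1) x) (psi q (k+1) (q*x)) (psi q (k+1) (q^2*x))
      - (q^(k+2) + (q^(k+1))⁻¹) * yy q x (psi q (k+1) x) (psi q (k+1) (q*x)))
      = cc q k * yy q x (psi q k x) (psi q k (q*x)) := by
  cases k with
  | zero => simpa [psi_zero] using core1 q x h2 h0 hx hq hx1 hx2 hx3
  | succ l => exact core2 q x h2 h0 hx hq hx1 hx2 hx3 l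

lemma psum (q x N : F) (h2 : (2:F) ≠ 0) (h0 : q ≠ 0) (hx : x ≠ 0) (hq : ∀ k : ℕ, q^(k+1) ≠ 1)
    (hx1 : 1 + x ≠ 0) (hx2 : 1 + q * x ≠ 0) (hx3 : 1 + q^2 * x ≠ 0) (M : ℕ) :
    ∑ k ∈ range (M+1), cc q k * psi q k N *
      (vv q x (psi q k (x/q)) (psi q k x) (psi q k (q*x)) (psi q k (q^2*x))
        - (N⁻¹ + q * N) * yy q x (psi q k x) (psi q k (q*x)))
      = - (cc q M * psi q (M+1) N * yy q x (psi q M x) (psi q M (q*x))) := by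
  induction M with
  | zero =>
    simp only [zero_add, Finset.sum_range_one, psi_succ, psi_zero, pow_zero, pow_one]
    linear_combination cc q 0 * core0 q x
  | succ M ih =>
    rw [Finset.sum_range_succ, ih, psi_succ q N (M+1)]
    linear_combination psi q (M+1) N * core q x h2 h0 hx hq hx1 hx2 hx3 M

noncomputable def pp (q : F) (n m : ℕ) : F :=
  ∑ k ∈ range (n+3), cc q k * psi q k (q^n) * psi q k (q^m)

lemma pp_rec (q : F) (h2 : (2:F) ≠ 0) (h0 : q ≠ 0) (hq : ∀ k : ℕ, q^(k+1) ≠ 1) (n m : ℕ) :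
    vv q (q^(m+1)) (pp q n m) (pp q n (m+1)) (pp q n (m+2)) (pp q n (m+3))
      - ((q^n)⁻¹ + q * q^n) * yy q (q^(m+1)) (pp q n (m+1)) (pp q n (m+2)) = 0 := by
  have a1 := one_add_ne q hq m
  have a2 := one_add_ne q hq (m+1)
  have a3 := one_add_ne q hq (m+2)
  have h := psum q (q^(m+1)) (q^n) h2 h0 (pow_ne_zero _ h0) hq (by rwa [pow_succ])
    (by rwa [mul_comm]) (by rwa [show q^2 * q^(m+1) = q^(m+2)*q by ring]) (n+2)
  rw [psi_vanish q (n+2+1) n (by omega)] at h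
  rw [show q^(m+1)/q = q^m by rw [pow_succ]; field_simp, show q * q^(m+1) = q^(m+2) by ring,
    show q^2 * q^(m+1) = q^(m+3) by ring] at h
  rw [mul_zero, zero_mul, neg_zero] at h
  rw [← h]
  simp only [pp, vv, yy, ww, uu, Finset.mul_sum, ← Finset.sum_sub_distrib, ← Finset.sum_add_distrib]
  apply Finset.sum_congr rfl
  intro k _
  ring

lemma prod_rec (q x N s a0 a1 a2 a3 b0 b1 b2 b3 : F)
    (h2 : (2:F) ≠ 0) (hN : N ≠ 0)
    (hx1 : 1 + x ≠ 0) (hx2 : 1 + q * x ≠ 0) (hx3 : 1 + q^2 * x ≠ 0)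
    (e1 : b1 + b0 = a1 + N * a0) (f1 : b1 - b0 = x * (a1 - N * a0))
    (e2 : b2 + b1 = a2 + N * a1) (f2 : b2 - b1 = q * x * (a2 - N * a1))
    (e3 : b3 + b2 = a3 + N * a2) (f3 : b3 - b2 = q^2 * x * (a3 - N * a2)) :
    vv q x (s * (a0*b0)) (s * (a1*b1) / N) (s * (a2*b2) / N^2) (s * (a3*b3) / N^3)
      - (N⁻¹ + q * N) * yy q x (s * (a1*b1) / N) (s * (a2*b2) / N^2) = 0 := by
  have h4 : (4:F) ≠ 0 := by
    rw [show (4:F) = 2 * 2 by norm_num]; exact mul_ne_zero h2 h2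
  have key : ∀ x a0 a1 b0 b1 s : F, 1 + x ≠ 0 → b1 + b0 = a1 + N * a0 → b1 - b0 = x * (a1 - N * a0) →
      uu x (s * (a0*b0)) (s * (a1*b1) / N) = s * (a1^2 - N^2 * a0^2) / N ∧
      ww x (s * (a0*b0)) (s * (a1*b1) / N) = s * (b0^2 + x * N^2 * a0^2) / N := by
    intro x a0 a1 b0 b1 s hx e f
    have g1 : b1 = ((1 + x) * a1 + N * (1 - x) * a0) / 2 := by
      field_simp; linear_combination e + f
    have g0 : b0 = ((1 - x) * a1 + N * (1 + x) * a0) / 2 := by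
      field_simp; linear_combination e - f
    have hu : uu x (s * (a0*b0)) (s * (a1*b1) / N) = s * (a1^2 - N^2 * a0^2) / N := by
      unfold uu
      rw [g1, g0]; field_simp; ring
    refine ⟨hu, ?_⟩
    unfold ww
    rw [hu, g0]; field_simp; ring
  obtain ⟨u1, w1⟩ := key x a0 a1 b0 b1 s hx1 e1 f1
  obtain ⟨u2, w2⟩ := key (q*x) a1 a2 b1 b2 (s/N) hx2 e2 f2
  obtain ⟨u3, w3⟩ := key (q^2*x) a2 a3 b2 b3 (s/N^2) hx3 e3 f3
  rw [show s / N * (a1*b1) = s * (a1*b1) / N by ring,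
    show s / N * (a2*b2) / N = s * (a2*b2) / N^2 by field_simp] at u2 w2
  rw [show s / N^2 * (a2*b2) = s * (a2*b2) / N^2 by ring,
    show s / N^2 * (a3*b3) / N = s * (a3*b3) / N^3 by field_simp] at u3 w3
  unfold vv yy
  rw [u1, w1, u2, w2, w3]
  have d1 : b1^2 - b0^2 = x * (a1^2 - N^2*a0^2) := by
    linear_combination (b1 - b0) * e1 + (a1 + N * a0) * f1
  have d2 : b2^2 - b1^2 = q * x * (a2^2 - N^2*a1^2) := by
    linear_combination (b2 - b1) * e2 + (a2 + N * a1) * f2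
  have e0 : b0^2 = b1^2 - x * (a1^2 - N^2*a0^2) := by linear_combination -d1
  have e2 : b2^2 = b1^2 + q * x * (a2^2 - N^2*a1^2) := by linear_combination d2
  rw [e0, e2]
  field_simp
  ring

noncomputable def QQ (q : F) (n m : ℕ) : F := Dq q m n * Dstar q m n / (q^n)^m

lemma QQ_rec (q : F) (h2 : (2:F) ≠ 0) (h0 : q ≠ 0) (hq : ∀ k : ℕ, q^(k+1) ≠ 1) (n m : ℕ) :
    vv q (q^(m+1)) (QQ q n m) (QQ q n (m+1)) (QQ q n (m+2)) (QQ q n (m+3))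
      - ((q^n)⁻¹ + q * q^n) * yy q (q^(m+1)) (QQ q n (m+1)) (QQ q n (m+2)) = 0 := by
  have a1 := one_add_ne q hq m
  have a2 := one_add_ne q hq (m+1)
  have a3 := one_add_ne q hq (m+2)
  have hN : q^n ≠ 0 := pow_ne_zero _ h0
  have hN' : (q^n)^m ≠ 0 := pow_ne_zero _ hN
  have h := prod_rec q (q^(m+1)) (q^n) ((q^n)^m)⁻¹ _ _ _ _ _ _ _ _ h2 hN
    (by rwa [pow_succ])
    (by rwa [mul_comm]) (by rwa [show q^2 * q^(m+1) = q^(m+2)*q by ring])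
    (R1 q hq m n) (R2 q hq m n) (R1 q hq (m+1) n)
    (by rw [R2 q hq (m+1) n]; ring) (R1 q hq (m+2) n) (by rw [R2 q hq (m+2) n]; ring)
  rw [← h]
  have g : ∀ j, QQ q n (m+j) = ((q^n)^m)⁻¹ * (Dq q (m+j) n * Dstar q (m+j) n) / (q^n)^j := by
    intro j
    unfold QQ
    rw [pow_add (q^n)]; field_simp
  have g0 := g 0
  have g1 := g 1
  rw [pow_zero, div_one, add_zero] at g0
  rw [pow_one] at g1
  rw [g0, g1, g 2, g 3]

lemma step (q x l p0 p1 p2 p3 p3' : F) (h2 : (2:F) ≠ 0) (hx : 1 - q^2 * x ≠ 0) (hx3 : 1 + q^2 * x ≠ 0)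
    (h : vv q x p0 p1 p2 p3 - l * yy q x p1 p2 = 0)
    (h' : vv q x p0 p1 p2 p3' - l * yy q x p1 p2 = 0) : p3 = p3' := by
  have h4 : (4:F) ≠ 0 := by
    rw [show (4:F) = 2 * 2 by norm_num]; exact mul_ne_zero h2 h2
  have e : (1 - q^2*x)^2/4 * (2 / (1 + q^2*x)) * (p3 - p3') = 0 := by
    unfold vv ww uu at *
    linear_combination h - h'
  have : (1 - q^2*x)^2/4 * (2 / (1 + q^2*x)) ≠ 0 := by
    simp [hx, hx3, h4, h2]
  exact sub_eq_zero.mp ((mul_eq_zero.mp e).resolve_left this)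

lemma pp_small (q : F) (n m : ℕ) (hm : m < 3) :
    pp q n m = ∑ k ∈ range 3, cc q k * psi q k (q^n) * psi q k (q^m) := by
  unfold pp
  symm
  apply Finset.sum_subset
  · intro k; simp; omega
  · intro k _ hk
    rw [psi_vanish q k m (by simp at hk; omega)]; ring

lemma base (q : F) (h2 : (2:F) ≠ 0) (h0 : q ≠ 0) (hq : ∀ k : ℕ, q^(k+1) ≠ 1) (n : ℕ) :
    pp q n 0 = QQ q n 0 ∧ pp q n 1 = QQ q n 1 ∧ pp q n 2 = QQ q n 2 := by
  rw [pp_small q n 0 (by omega), pp_small q n 1 (by omega), pp_small q n 2 (by omega)]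
  have hN : q^n ≠ 0 := pow_ne_zero _ h0
  obtain ⟨a0, b0⟩ := Dq_zero q hq n
  have e1 := R1 q hq 0 n
  have f1 := R2 q hq 0 n
  have e2 := R1 q hq 1 n
  have f2 := R2 q hq 1 n
  have s1 := one_sub_ne q hq 0
  have s1' := one_add_ne q hq 0
  have s2 := one_sub_ne q hq 1
  have s3 := one_sub_ne q hq 2
  have c0 : cc q 0 = 1 := by simp [cc, qPoch_zero]
  have c1 := cc_succ q hq 0
  have c2 := cc_succ q hq 1
  norm_num [a0, b0, c0] at e1 f1 e2 f2 s1 s1' s2 s3 c1 c2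
  rw [← pow_succ] at s3
  norm_num at s3
  have c1' : cc q 1 = 2 * q / (1 - q)^4 := by
    rw [eq_div_iff (by simp [s1])]; linear_combination c1
  have c2' : cc q 2 = cc q 1 * (q^3 * (1 + q)) / ((1 - q^3) * (1 - q^2)^3) := by
    rw [← pow_two] at s2
    rw [eq_div_iff (by simp [s2, s3])]; linear_combination c2
  rw [c1'] at c2'
  have a1 : Dq q 1 n = (2 - q^n * (1 + q)) / (1 - q) := by
    rw [eq_div_iff s1]; linear_combination f1 - e1
  have b1 : Dstar q 1 n = Dq q 1 n + q^n - 1 := by linear_combination e1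
  have s2' : 1 - q^2 ≠ 0 := by rwa [pow_two]
  have a2 : Dq q 2 n = (2 * Dstar q 1 n - q^n * (1 + q^2) * Dq q 1 n) / (1 - q^2) := by
    rw [eq_div_iff s2']; linear_combination f2 - e2
  have b2 : Dstar q 2 n = Dq q 2 n + q^n * Dq q 1 n - Dstar q 1 n := by linear_combination e2
  simp only [Finset.sum_range_succ, Finset.sum_range_zero, psi_succ, psi_zero, QQ]
  rw [b2, a2, b1, a1, a0, b0, c0, c2', c1']
  generalize q^n = N at *
  have t : 1 - q^2 = (1-q)*(1+q) := by ring
  refine ⟨?_, ?_, ?_⟩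
  · norm_num
    rw [show 1 + q - (q + 1) = 0 by ring]; ring
  · field_simp
    ring
  · rw [t]
    field_simp
    ring

lemma pp_eq (q : F) (h2 : (2:F) ≠ 0) (h0 : q ≠ 0) (hq : ∀ k : ℕ, q^(k+1) ≠ 1) (n m : ℕ) :
    pp q n m = QQ q n m ∧ pp q n (m+1) = QQ q n (m+1) ∧ pp q n (m+2) = QQ q n (m+2) := by
  induction m with
  | zero => exact base q h2 h0 hq n
  | succ m ih =>
    obtain ⟨i0, i1, i2⟩ := ih
    refine ⟨i1, i2, ?_⟩
    have h := pp_rec q h2 h0 hq n m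
    have h' := QQ_rec q h2 h0 hq n m
    rw [i0, i1, i2] at h
    have e : q^2 * q^(m+1) = q^(m+2) * q := by ring
    exact step q _ _ _ _ _ _ _ h2 (by rw [e]; exact one_sub_ne q hq (m+2))
      (by rw [e]; exact one_add_ne q hq (m+2)) h h'

lemma psi_nat (q : F) (h0 : q ≠ 0) (hq : ∀ k : ℕ, q^(k+1) ≠ 1) (k m : ℕ) (h : k ≤ m) :
    psi q k (q^m) = ((q^m)^k)⁻¹ * (qPoch q q (m+k) / qPoch q q (m-k)) := by
  rw [psi_poch q _ h0 (pow_ne_zero _ h0)]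
  congr 1
  rw [eq_div_iff (qPoch_ne q hq _)]
  obtain ⟨d, rfl⟩ : ∃ d, m = k + d := ⟨m - k, by omega⟩
  rw [Nat.add_sub_cancel_left, show k + d + k = d + 2 * k by ring, qPoch_add, mul_comm]
  congr 2
  rw [pow_add]; field_simp

lemma term_eq (q : F) (h0 : q ≠ 0) (hq : ∀ k : ℕ, q^(k+1) ≠ 1) (n m k : ℕ) (hk : k ≤ n) :
    q ^ (((m : ℤ) - k) * ((n : ℤ) - k)) * qBin q (n + k) (2 * k) * qBin q m k *
        qBin q (m + k) k * qPoch q (-1) k * qPoch q (-q) k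
      = (q^n)^m * (cc q k * psi q k (q^n) * psi q k (q^m)) := by
  by_cases hm : k ≤ m
  · rw [psi_nat q h0 hq k m hm, psi_nat q h0 hq k n hk]
    unfold qBin cc
    rw [if_pos (by omega), if_pos hm, if_pos (by omega), show n + k - 2*k = n - k by omega,
      Nat.add_sub_cancel]
    have e : q ^ (((m : ℤ) - k) * ((n : ℤ) - k)) = (q^n)^m * q^(k^2) * ((q^m)^k)⁻¹ * ((q^n)^k)⁻¹ := by
      have : ((m : ℤ) - k) * ((n : ℤ) - k) = ((n * m : ℕ) : ℤ) + ((k^2 : ℕ) : ℤ) - ((m * k : ℕ) : ℤ) - ((n*k : ℕ) : ℤ) := by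
        push_cast; ring
      rw [this, zpow_sub₀ h0, zpow_sub₀ h0, zpow_add₀ h0]
      simp only [zpow_natCast, pow_mul]
      field_simp
    rw [e]
    have i1 := qPoch_ne q hq k
    have i2 := qPoch_ne q hq (2*k)
    have i3 := qPoch_ne q hq m
    have i4 := qPoch_ne q hq (m-k)
    have i5 := qPoch_ne q hq (n-k)
    generalize qPoch q q k = X1 at *
    generalize qPoch q q (2*k) = X2 at *
    generalize qPoch q q m = X3 at *
    generalize qPoch q q (m-k) = X4 at *
    generalize qPoch q q (n-k) = X5 at *
    field_simp
  · rw [psi_vanish q k m (by omega)]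
    have : qBin q m k = 0 := by unfold qBin; rw [if_neg hm]
    rw [this]; ring

lemma main (q : F) (h2 : (2:F) ≠ 0) (h0 : q ≠ 0) (hq : ∀ k : ℕ, q^(k+1) ≠ 1) (m n : ℕ) :
    Dq q m n * Dstar q m n = ∑ k ∈ Finset.range (n + 1),
      q ^ (((m : ℤ) - k) * ((n : ℤ) - k)) * qBin q (n + k) (2 * k) * qBin q m k *
        qBin q (m + k) k * qPoch q (-1) k * qPoch q (-q) k := by
  have hN : (q^n)^m ≠ 0 := pow_ne_zero _ (pow_ne_zero _ h0)
  have h := (pp_eq q h2 h0 hq n m).1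
  unfold QQ at h
  rw [eq_div_iff hN] at h
  rw [← h, mul_comm]
  unfold pp
  rw [Finset.sum_range_succ, Finset.sum_range_succ, psi_vanish q (n+1) n (by omega),
    psi_vanish q (n+1+1) n (by omega)]
  simp only [mul_zero, zero_mul, add_zero]
  rw [Finset.mul_sum]
  apply Finset.sum_congr rfl
  intro k hk
  rw [term_eq q h0 hq n m k (by simp at hk; omega)]

end QD

theorem Dq_mul_Dstar (m n : ℕ) :
    Dq q m n * Dstar q m n = ∑ k ∈ Finset.range (n + 1),
      q ^ (((m : ℤ) - k) * ((n : ℤ) - k)) * qBin q (n + k) (2 * k) * qBin q m k *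
        qBin q (m + k) k * qPoch q (-1) k * qPoch q (-q) k := by
  apply QD.main
  · exact two_ne_zero
  · unfold q
    rw [Ne, IsFractionRing.to_map_eq_zero_iff]
    exact Polynomial.X_ne_zero
  · intro k h
    unfold q at h
    rw [← map_pow, ← map_one (algebraMap (Polynomial ℚ) Fq)] at h
    have h := IsFractionRing.injective (Polynomial ℚ) Fq h
    have := congrArg Polynomial.natDegree h
    simp at this
end

section
/- Let m and n be positive integers. Then ∑_{k=0}^{n-1} ((1-q^{m})(1-q^{m+1})(1-q^{2k+1}) / ((1-q^2)(1-q^n)^2)) D_q(m,k) D_{q^{-1}}(m,k) q^{-k} is a Laurent polynomial in q with non-negative integer coefficients. -/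
open Finset

section helpers
variable {F : Type*} [Field F]

theorem qPoch_succ (q : F) (n : ℕ) : qPoch q q (n + 1) = qPoch q q n * (1 - q ^ (n + 1)) := by
  unfold qPoch
  rw [Finset.prod_range_succ, pow_succ']

theorem qPoch_zero (q : F) : qPoch q q 0 = 1 := by
  simp [qPoch]

/-- not a root of unity, nonzero -/
def Gen (q : F) : Prop := q ≠ 0 ∧ ∀ k : ℕ, 1 - q ^ (k + 1) ≠ 0

theorem qPoch_ne {q : F} (h : Gen q) (n : ℕ) : qPoch q q n ≠ 0 := by
  induction n with
  | zero => simp [qPoch_zero]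
  | succ n ih => rw [qPoch_succ]; exact mul_ne_zero ih (h.2 n)

/-- reciprocal of `(q;q)_{n-k}`, or zero -/
noncomputable def rr (q : F) (n k : ℕ) : F := if k ≤ n then (qPoch q q (n - k))⁻¹ else 0

theorem rr_succ_succ (q : F) (n k : ℕ) : rr q (n + 1) (k + 1) = rr q n k := by
  simp [rr]

theorem rr_step {q : F} (h : Gen q) (n k : ℕ) :
    q ^ k * rr q n (k + 1) = (q ^ k - q ^ n) * rr q n k := by
  unfold rr
  rcases lt_trichotomy k n with hk | hk | hk
  · obtain ⟨a, rfl⟩ := Nat.exists_eq_add_of_lt hk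
    have h1 : k + a + 1 - (k + 1) = a := by omega
    have h2 : k + a + 1 - k = a + 1 := by omega
    rw [if_pos (by omega), if_pos (by omega), h1, h2, qPoch_succ]
    have := qPoch_ne h a
    have := h.2 a
    field_simp
    ring
  · subst hk
    simp
  · rw [if_neg (by omega), if_neg (by omega)]; simp

theorem qBin_eq (q : F) (n k : ℕ) :
    qBin q n k = qPoch q q n * (qPoch q q k)⁻¹ * rr q n k := by
  unfold qBin rr
  split_ifs
  · rw [div_eq_mul_inv, mul_inv, mul_assoc]
  · simp

theorem qBin_right {q : F} (h : Gen q) (n k : ℕ) :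
    q ^ k * (1 - q ^ (k + 1)) * qBin q n (k + 1) = (q ^ k - q ^ n) * qBin q n k := by
  have h1 := rr_step h n k
  have := qPoch_ne h k
  have := h.2 k
  rw [qBin_eq, qBin_eq, qPoch_succ]
  field_simp
  linear_combination qPoch q q n * h1

theorem qBin_diag {q : F} (h : Gen q) (n k : ℕ) :
    (1 - q ^ (k + 1)) * qBin q (n + 1) (k + 1) = (1 - q ^ (n + 1)) * qBin q n k := by
  have := qPoch_ne h k
  have := h.2 k
  rw [qBin_eq, qBin_eq, qPoch_succ, qPoch_succ, rr_succ_succ]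
  field_simp

theorem qBin_zero {q : F} (h : Gen q) (n : ℕ) : qBin q n 0 = 1 := by
  have := qPoch_ne h n
  simp [qBin, qPoch_zero, this]

theorem qBin_pascal {q : F} (h : Gen q) (n k : ℕ) :
    qBin q (n + 1) (k + 1) = qBin q n k + q ^ (k + 1) * qBin q n (k + 1) := by
  have h1 := qBin_right h n k
  have h2 := qBin_diag h n k
  apply mul_left_cancel₀ (h.2 k)
  linear_combination h2 - q * h1

theorem qBin_lt (q : F) (n k : ℕ) (h : n < k) : qBin q n k = 0 := by
  unfold qBin; rw [if_neg (by omega)]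

/-- symmetric summand -/
noncomputable def ff (q : F) (m n k : ℕ) : F :=
  q ^ (k * (k - 1) / 2) * qPoch q q (n + m - k) * (qPoch q q k)⁻¹ * rr q n k * rr q m k

theorem ff_symm (q : F) (m n k : ℕ) : ff q m n k = ff q n m k := by
  unfold ff; rw [add_comm n m]; ring

theorem Dq_term {q : F} (h : Gen q) (m n k : ℕ) :
    q ^ (k * (k - 1) / 2) * qBin q n k * qBin q (n + m - k) n = ff q m n k := by
  rw [qBin_eq, qBin_eq]
  unfold ff
  have h1 : k ≤ n → rr q (n + m - k) n = rr q m k := by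
    intro hk
    unfold rr
    by_cases hm : k ≤ m
    · rw [if_pos (by omega), if_pos hm]; congr 2; omega
    · rw [if_neg (by omega), if_neg hm]
  by_cases hk : k ≤ n
  · rw [h1 hk]
    have := qPoch_ne h n
    have := qPoch_ne h k
    field_simp
  · have : rr q n k = 0 := by unfold rr; rw [if_neg hk]
    rw [this]; simp

theorem rr_lt (q : F) (n k : ℕ) (h : n < k) : rr q n k = 0 := by
  unfold rr; rw [if_neg (by omega)]

theorem Dq_eq_s8 {q : F} (h : Gen q) (m n N : ℕ) (hN : n + 1 ≤ N) :
    Dq q m n = ∑ k ∈ Finset.range N, ff q m n k := by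
  unfold Dq
  rw [Finset.sum_congr rfl (fun k _ => Dq_term h m n k)]
  apply Finset.sum_subset (by simpa using hN)
  intro k _ hk
  have hk' : n < k := by simpa using hk
  unfold ff; rw [rr_lt q n k hk']; simp

theorem Dq_symm {q : F} (h : Gen q) (m n : ℕ) : Dq q m n = Dq q n m := by
  rw [Dq_eq_s8 h m n (m + n + 1) (by omega), Dq_eq_s8 h n m (m + n + 1) (by omega)]
  exact Finset.sum_congr rfl fun k _ => ff_symm q m n k

theorem tri (k : ℕ) : (k + 1) * (k + 1 - 1) / 2 = k * (k - 1) / 2 + k := by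
  have := Nat.triangle_succ k
  simpa using this

theorem ff_rec {q : F} (h : Gen q) (m n k : ℕ) :
    ff q (m + 1) (n + 1) (k + 1) = ff q (m + 1) n (k + 1) + q ^ n * ff q m n k
      + q ^ (n + 1) * ff q m (n + 1) (k + 1) := by
  unfold ff
  by_cases hk : k ≤ n ∧ k ≤ m
  · obtain ⟨⟨a, rfl⟩, ⟨b, rfl⟩⟩ := And.imp Nat.exists_eq_add_of_le Nat.exists_eq_add_of_le hk
    have e1 : k + a + 1 + (k + b + 1) - (k + 1) = (k + a + b) + 1 := by omega
    have e2 : k + a + (k + b + 1) - (k + 1) = k + a + b := by omega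
    have e3 : k + a + (k + b) - k = k + a + b := by omega
    have e4 : k + a + 1 + (k + b) - (k + 1) = k + a + b := by omega
    rw [e1, e2, e3, e4, tri, rr_succ_succ, rr_succ_succ, qPoch_succ, qPoch_succ]
    have h1 := rr_step h (k + a) k
    have h2 := rr_step h (k + b) k
    have h0 := h.1
    have h3 : rr q (k + a) (k + 1) = (1 - q ^ a) * rr q (k + a) k := by
      apply mul_left_cancel₀ (pow_ne_zero k h0)
      rw [h1]; ring
    have h4 : rr q (k + b) (k + 1) = (1 - q ^ b) * rr q (k + b) k := by
      apply mul_left_cancel₀ (pow_ne_zero k h0)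
      rw [h2]; ring
    rw [h3, h4]
    have := qPoch_ne h k
    have := h.2 k
    field_simp
    ring
  · by_cases hn : k ≤ n
    · have hm : m < k := by omega
      rw [rr_lt q (m + 1) (k + 1) (by omega), rr_lt q m k hm, rr_lt q m (k + 1) (by omega)]
      simp
    · rw [rr_lt q (n + 1) (k + 1) (by omega), rr_lt q n k (by omega), rr_lt q n (k + 1) (by omega)]
      simp

theorem ff_zero {q : F} (h : Gen q) (m n : ℕ) :
    ff q (m + 1) (n + 1) 0 = ff q (m + 1) n 0 + q ^ (n + 1) * ff q m (n + 1) 0 := by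
  unfold ff rr
  have e1 : n + 1 + (m + 1) - 0 = (m + n + 1) + 1 := by omega
  have e2 : n + (m + 1) - 0 = m + n + 1 := by omega
  have e3 : n + 1 + m - 0 = m + n + 1 := by omega
  simp only [Nat.zero_le, if_true, Nat.sub_zero] at *
  rw [e1, e2, e3, qPoch_succ q (m + n + 1), qPoch_succ q m, qPoch_succ q n]
  have := qPoch_ne h n
  have := qPoch_ne h m
  have := h.2 n
  have := h.2 m
  have := qPoch_ne h 0
  field_simp
  ring

theorem Dq_rec {q : F} (h : Gen q) (m n : ℕ) :
    Dq q (m + 1) (n + 1) = Dq q (m + 1) n + q ^ n * Dq q m n + q ^ (n + 1) * Dq q m (n + 1) := by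
  rw [Dq_eq_s8 h (m + 1) (n + 1) (n + 2) (by omega), Dq_eq_s8 h (m + 1) n (n + 2) (by omega),
    Dq_eq_s8 h m n (n + 1) (by omega), Dq_eq_s8 h m (n + 1) (n + 2) (by omega)]
  rw [Finset.sum_range_succ', Finset.sum_range_succ' _ (n + 1), Finset.sum_range_succ' _ (n + 1),
    ff_zero h, Finset.sum_congr rfl (fun k _ => ff_rec h m n k)]
  rw [Finset.sum_add_distrib, Finset.sum_add_distrib, ← Finset.mul_sum, ← Finset.mul_sum]
  ring

theorem Dq_rec' {q : F} (h : Gen q) (m n : ℕ) :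
    Dq q (m + 1) (n + 1) = Dq q m (n + 1) + q ^ m * Dq q m n + q ^ (m + 1) * Dq q (m + 1) n := by
  rw [Dq_symm h (m + 1) (n + 1), Dq_rec h, Dq_symm h (n + 1) m, Dq_symm h n m, Dq_symm h n (m + 1)]

theorem Dq_zero {q : F} (h : Gen q) (m : ℕ) : Dq q m 0 = 1 := by
  unfold Dq
  simp [qBin_zero h]

theorem Dq_I {q : F} (h : Gen q) (m n : ℕ) :
    (1 - q ^ (n + 1)) * Dq q m (n + 1) =
      (1 - q ^ (m + 1)) * Dq q (m + 1) n + (q ^ n - q ^ m) * Dq q m n := by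
  linear_combination Dq_rec h m n - Dq_rec' h m n

theorem Dq_II {q : F} (h : Gen q) (m n : ℕ) :
    (1 - q ^ (n + 1)) * Dq q (m + 1) (n + 1) =
      (1 - q ^ (n + m + 2)) * Dq q (m + 1) n + q ^ n * (1 - q ^ (m + 1)) * Dq q m n := by
  linear_combination (1 - q ^ (n + 1)) * Dq_rec h m n + q ^ (n + 1) * Dq_I h m n

theorem Dq_three {q : F} (h : Gen q) (m n : ℕ) :
    (1 - q ^ (n + 2)) * Dq q (m + 1) (n + 2) =
      (1 + q ^ (n + 1) - q ^ (m + 1) - q ^ (n + m + 3)) * Dq q (m + 1) (n + 1)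
        + q ^ (m + 1) * (1 - q ^ (n + 1)) * Dq q (m + 1) n := by
  apply mul_left_cancel₀ (h.2 n)
  have h1 := Dq_II h m (n + 1)
  have h2 := Dq_II h m n
  have h3 := Dq_I h m n
  linear_combination (1 - q ^ (n + 1)) * h1 + q ^ (n + 1) * (1 - q ^ (m + 1)) * h3
    - (q ^ (n + 1) - q ^ (m + 1)) * h2

theorem Dq_one {q : F} (h : Gen q) (m : ℕ) :
    (1 - q) * Dq q (m + 1) 1 = 2 - q ^ (m + 1) - q ^ (m + 2) := by
  have h1 := Dq_II h m 0
  rw [Dq_zero h, Dq_zero h] at h1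
  simp only [zero_add, pow_one, pow_zero] at h1
  linear_combination h1

theorem Gen_inv {q : F} (h : Gen q) : Gen q⁻¹ := by
  refine ⟨inv_ne_zero h.1, fun k => ?_⟩
  have h1 := h.2 k
  have h0 := pow_ne_zero (k + 1) h.1
  intro h2
  apply h1
  rw [inv_pow] at h2
  field_simp at h2
  linear_combination -h2

theorem Bq_three {q : F} (h : Gen q) (m n : ℕ) :
    q ^ (m + 1) * (1 - q ^ (n + 2)) * Dq q⁻¹ (m + 1) (n + 2) =
      (1 + q ^ (n + 2) - q ^ (m + 2) - q ^ (n + m + 3)) * Dq q⁻¹ (m + 1) (n + 1)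
        + q * (1 - q ^ (n + 1)) * Dq q⁻¹ (m + 1) n := by
  have h1 := Dq_three (Gen_inv h) m n
  have h0 := h.1
  have c1 : q ^ (m + 1) * (1 - q ^ (n + 2)) = -q ^ (n + m + 3) * (1 - q⁻¹ ^ (n + 2)) := by
    rw [inv_pow]; field_simp; ring
  have c2 : (1 + q ^ (n + 2) - q ^ (m + 2) - q ^ (n + m + 3)) = -q ^ (n + m + 3) *
      (1 + q⁻¹ ^ (n + 1) - q⁻¹ ^ (m + 1) - q⁻¹ ^ (n + m + 3)) := by
    simp only [inv_pow]; field_simp; ring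
  have c3 : q * (1 - q ^ (n + 1)) = -q ^ (n + m + 3) * (q⁻¹ ^ (m + 1) * (1 - q⁻¹ ^ (n + 1))) := by
    simp only [inv_pow]; field_simp; ring
  rw [c1, c2, c3]
  linear_combination -q ^ (n + m + 3) * h1

theorem Bq_one {q : F} (h : Gen q) (m : ℕ) :
    q ^ (m + 1) * (1 - q) * Dq q⁻¹ (m + 1) 1 = 1 + q - 2 * q ^ (m + 2) := by
  have h1 := Dq_one (Gen_inv h) m
  have h0 := h.1
  have c1 : q ^ (m + 1) * (1 - q) = -q ^ (m + 2) * (1 - q⁻¹) := by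
    field_simp; ring
  have c2 : 1 + q - 2 * q ^ (m + 2) = -q ^ (m + 2) * (2 - q⁻¹ ^ (m + 1) - q⁻¹ ^ (m + 2)) := by
    simp only [inv_pow]; field_simp; ring
  rw [c1, c2, ← h1]; ring

end helpers

section closedform
variable {F : Type*} [Field F]

noncomputable def kk (q x : F) (k : ℕ) : F :=
  q * (q ^ k - x) * (1 - x * q ^ (k + 1)) * (1 + q ^ k) /
    (x * (1 - q ^ (k + 1)) ^ 3 * (1 - q ^ (2 * k + 1)))

noncomputable def tt (q x y : F) : ℕ → F
  | 0 => 1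
  | k + 1 => tt q x y k * kk q x k * ((q ^ k - y) * (1 - y * q ^ (k + 1)) / y)

theorem tt_zero (q x y : F) : tt q x y 0 = 1 := rfl

theorem tt_succ (q x y : F) (k : ℕ) : tt q x y (k + 1) =
    tt q x y k * kk q x k * ((q ^ k - y) * (1 - y * q ^ (k + 1)) / y) := rfl

theorem tt_shift {q : F} (h : Gen q) (x : F) {y : F} (hy : y ≠ 0) (k : ℕ) :
    tt q x (q * y) k * (q ^ k - q * y) = tt q x y k * (1 - y * q ^ (k + 1)) := by
  have h0 := h.1
  induction k with
  | zero => simp [tt_zero, mul_comm]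
  | succ k ih =>
    rw [tt_succ, tt_succ]
    field_simp
    linear_combination (kk q x k * (1 - q * y * q ^ (k + 1)) * (q ^ (k + 1) - q * y)) * ih

theorem tt_vanish (q x : F) (n k : ℕ) (hk : n < k) : tt q x (q ^ n) k = 0 := by
  induction k, hk using Nat.le_induction with
  | base => rw [tt_succ]; simp
  | succ k _ ih => rw [tt_succ, ih]; simp

noncomputable def cT (q x y : F) (k : ℕ) : F :=
  tt q x y k * (q ^ k - y) / (1 - q ^ (2 * k + 1)) * ((1 + q ^ k) - (1 + q ^ (k + 1)) * x)

noncomputable def eT (q x y : F) (k : ℕ) : F :=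
  tt q x y k * (q ^ k - y) / (1 - q ^ (2 * k + 1)) * ((1 + q ^ (k + 1)) - q * (1 + q ^ k) * x)

theorem rel1 {q : F} (h : Gen q) (x : F) {y : F} (hy : y ≠ 0) (k : ℕ) :
    cT q x (q * y) k = (1 + y - x - q * x * y) * tt q x y k + eT q x y k := by
  unfold cT eT
  rw [tt_shift h x hy]
  have := h.2 (2 * k)
  field_simp
  ring

theorem rel2 {q : F} (h : Gen q) (x : F) {y : F} (hy : y ≠ 0) (k : ℕ) :
    eT q x (q * y) k = (1 + q * y - q * x - q * x * y) * tt q x y k + q * cT q x y k := by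
  unfold cT eT
  rw [tt_shift h x hy]
  have := h.2 (2 * k)
  field_simp
  ring

noncomputable def gg (q x y : F) : ℕ → F
  | 0 => 0
  | k + 1 => tt q x y k * (1 - q * y ^ 2) * (1 + q ^ k) * (1 + q ^ (k + 1)) * (q ^ k - x) *
      (1 - x * q ^ (k + 1)) / (q ^ k * (1 - q ^ (2 * k + 1)))

set_option maxRecDepth 100000 in
set_option maxHeartbeats 2000000 in
theorem rel3 {q : F} (h : Gen q) {x : F} (hx : x ≠ 0) {y : F} (hy : y ≠ 0) (k : ℕ) :
    x * (1 - q * (q * y)) ^ 2 * tt q x (q * (q * y)) k =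
      (1 + (q * y) - x - q * x * (q * y)) * eT q x (q * (q * y)) k
      + (1 + q * (q * y) - q * x - q * x * (q * y)) * eT q x (q * y) k
      + q * x * (1 - q * y) ^ 2 * tt q x y k + gg q x (q * y) k - gg q x (q * y) (k + 1) := by
  have h0 := h.1
  have hqy : q * y ≠ 0 := mul_ne_zero h0 hy
  rcases k with _ | j
  · have := h.2 0
    simp only [zero_add, pow_one] at this
    simp only [gg, eT, tt_zero, Nat.mul_zero, zero_add, pow_one, pow_zero]
    field_simp
    ring
  · rw [rel2 h x hqy]
    unfold cT eT
    simp only [gg]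
    have s1 := tt_shift h x hqy j
    have s2 := tt_shift h x hy j
    have e1 : tt q x (q * (q * y)) (j + 1) = tt q x (q * y) j * kk q x j *
        ((1 - (q * y) * q ^ (j + 1)) * (1 - q * (q * y) * q ^ (j + 1)) / (q * (q * y))) := by
      rw [tt_succ]
      generalize tt q x (q * (q * y)) j = T1 at *
      generalize tt q x (q * y) j = T at *
      field_simp
      linear_combination kk q x j * (1 - q ^ 2 * y * q ^ (j + 1)) * s1
    have e2 : tt q x y (j + 1) = tt q x (q * y) j * kk q x j *
        ((q ^ j - q * y) * (q ^ j - y) / y) := by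
      rw [tt_succ]
      generalize tt q x (q * y) j = T at *
      field_simp
      linear_combination (-kk q x j * (q ^ j - y)) * s2
    rw [e1, e2, tt_succ q x (q * y)]
    unfold kk
    have d1 := h.2 j
    have d2 := h.2 (2 * j)
    have d3 := h.2 (2 * (j + 1))
    have d4 := pow_ne_zero j h0
    generalize tt q x (q * y) j = T
    have p1 : q ^ (j + 1) = q * q ^ j := pow_succ' q j
    have p2 : q ^ (j + 1 + 1) = q * (q * q ^ j) := by ring
    have p3 : q ^ (2 * j + 1) = q * (q ^ j) ^ 2 := by ring
    have p4 : q ^ (2 * (j + 1) + 1) = q ^ 3 * (q ^ j) ^ 2 := by ring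
    rw [p1] at d1
    rw [p3] at d2
    rw [p4] at d3
    rw [p4, p3, p2, p1]
    clear e1 e2 s1 s2 p1 p2 p3 p4
    generalize q ^ j = p at *
    field_simp
    ring

end closedform

section product
variable {F : Type*} [Field F]

theorem product_formula {q : F} (h : Gen q) (m n N : ℕ) (hN : n + 2 ≤ N) :
    (Dq q (m + 1) n * Dq q⁻¹ (m + 1) n = ∑ k ∈ range N, tt q (q ^ (m + 1)) (q ^ n) k) ∧
    (Dq q (m + 1) (n + 1) * Dq q⁻¹ (m + 1) (n + 1) =
      ∑ k ∈ range N, tt q (q ^ (m + 1)) (q ^ (n + 1)) k) ∧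
    ((1 - q ^ (n + 1)) * Dq q (m + 1) (n + 1) * Dq q⁻¹ (m + 1) n =
      ∑ k ∈ range N, cT q (q ^ (m + 1)) (q ^ (n + 1)) k) ∧
    (q ^ (m + 1) * (1 - q ^ (n + 1)) * Dq q (m + 1) n * Dq q⁻¹ (m + 1) (n + 1) =
      ∑ k ∈ range N, eT q (q ^ (m + 1)) (q ^ (n + 1)) k) := by
  have h0 := h.1
  set x := q ^ (m + 1) with hxdef
  have hx : x ≠ 0 := pow_ne_zero _ h0
  have R1 : ∀ n, ∑ k ∈ range N, cT q x (q ^ (n + 1)) k =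
      (1 + q ^ n - x - q * x * q ^ n) * ∑ k ∈ range N, tt q x (q ^ n) k
        + ∑ k ∈ range N, eT q x (q ^ n) k := by
    intro n
    rw [Finset.mul_sum, ← Finset.sum_add_distrib]
    refine Finset.sum_congr rfl fun k _ => ?_
    rw [pow_succ' q n]
    exact rel1 h x (pow_ne_zero n h0) k
  have R2 : ∀ n, ∑ k ∈ range N, eT q x (q ^ (n + 1)) k =
      (1 + q * q ^ n - q * x - q * x * q ^ n) * ∑ k ∈ range N, tt q x (q ^ n) k
        + q * ∑ k ∈ range N, cT q x (q ^ n) k := by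
    intro n
    rw [Finset.mul_sum, Finset.mul_sum, ← Finset.sum_add_distrib]
    refine Finset.sum_congr rfl fun k _ => ?_
    rw [pow_succ' q n]
    exact rel2 h x (pow_ne_zero n h0) k
  have R3' : ∀ y : F, y ≠ 0 → x * (1 - q * (q * y)) ^ 2 * ∑ k ∈ range N, tt q x (q * (q * y)) k =
      (1 + (q * y) - x - q * x * (q * y)) * ∑ k ∈ range N, eT q x (q * (q * y)) k
      + (1 + q * (q * y) - q * x - q * x * (q * y)) * ∑ k ∈ range N, eT q x (q * y) k
      + q * x * (1 - q * y) ^ 2 * ∑ k ∈ range N, tt q x y k - gg q x (q * y) N := by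
    intro y hy
    have ht : ∑ k ∈ range N, (gg q x (q * y) k - gg q x (q * y) (k + 1)) = - gg q x (q * y) N := by
      rw [Finset.sum_range_sub']; simp [gg]
    rw [sub_eq_add_neg _ (gg q x (q * y) N), ← ht]
    simp only [Finset.mul_sum]
    rw [← Finset.sum_add_distrib, ← Finset.sum_add_distrib, ← Finset.sum_add_distrib]
    refine Finset.sum_congr rfl fun k _ => ?_
    linear_combination rel3 h hx hy k
  have hg : ∀ n, n + 2 ≤ N → gg q x (q ^ n) N = 0 := by
    intro n hn
    obtain ⟨M, rfl⟩ : ∃ M, N = M + 1 := ⟨N - 1, by omega⟩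
    simp only [gg]
    rw [tt_vanish q x n M (by omega)]
    simp
  have T0 : 1 ≤ N → ∑ k ∈ range N, tt q x (q ^ 0) k = 1 := by
    intro hN
    obtain ⟨M, rfl⟩ : ∃ M, N = M + 1 := ⟨N - 1, by omega⟩
    rw [Finset.sum_range_succ', Finset.sum_eq_zero, tt_zero, zero_add]
    intro k _
    exact tt_vanish q x 0 (k + 1) (by omega)
  have Z : ∀ k, tt q x (q ^ 0) k * (q ^ k - q ^ 0) = 0 := by
    intro k
    rcases k with _ | k
    · simp
    · rw [tt_vanish q x 0 (k + 1) (by omega)]; simp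
  have C0 : ∑ k ∈ range N, cT q x (q ^ 0) k = 0 := by
    apply Finset.sum_eq_zero; intro k _; unfold cT; rw [Z]; simp
  have E0 : ∑ k ∈ range N, eT q x (q ^ 0) k = 0 := by
    apply Finset.sum_eq_zero; intro k _; unfold eT; rw [Z]; simp
  induction n with
  | zero =>
    have hc := R1 0
    have he := R2 0
    have ha := R3' (q⁻¹) (inv_ne_zero h0)
    have hgg := hg 0 hN
    have hA := Dq_one h m
    have hB := Bq_one h m
    rw [T0 (by omega), C0] at he
    rw [T0 (by omega), E0] at hc
    rw [mul_inv_cancel₀ h0, ← pow_zero q, hgg] at ha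
    rw [E0] at ha
    simp only [pow_zero, zero_add, pow_one, mul_one] at *
    rw [he] at ha
    have hq1 := h.2 0
    simp only [zero_add, pow_one] at hq1
    have hx2 : q ^ (m + 2) = q * x := by rw [hxdef]; ring
    rw [hx2] at hA hB
    rw [Dq_zero h, Dq_zero (Gen_inv h), hc, he, T0 (by omega)]
    refine ⟨by ring, ?_, by linear_combination hA, by linear_combination hB⟩
    apply mul_left_cancel₀ (mul_ne_zero hx (pow_ne_zero 2 hq1))
    rw [ha]
    linear_combination (x * (1 - q) * Dq q⁻¹ (m + 1) 1) * hA + (2 - x - q * x) * hB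
  | succ n ih =>
    obtain ⟨ia, ib, ic, ie⟩ := ih (by omega)
    have hA := Dq_three h m n
    have hB := Bq_three h m n
    have hc := R1 (n + 1)
    have he := R2 (n + 1)
    have ha := R3' (q ^ n) (pow_ne_zero n h0)
    have e1 : q * (q * q ^ n) = q ^ (n + 2) := by ring
    have e2 : q * q ^ n = q ^ (n + 1) := by ring
    rw [e1, e2, hg (n + 1) hN] at ha
    rw [← ib, ← ie] at hc
    rw [← ib, ← ic] at he
    rw [he, ← ie, ← ia] at ha
    have hx2 : q ^ (m + 2) = q * x := by rw [hxdef]; ring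
    have hx3 : q ^ (n + m + 3) = q * x * q ^ (n + 1) := by rw [hxdef]; ring
    rw [hx3] at hA
    rw [hx3, hx2] at hB
    rw [hc, he]
    refine ⟨ib, ?_, ?_, ?_⟩
    · apply mul_left_cancel₀ (mul_ne_zero hx (pow_ne_zero 2 (h.2 (n + 1))))
      rw [ha]
      linear_combination (x * (1 - q ^ (n + 2)) * Dq q⁻¹ (m + 1) (n + 2)) * hA +
        ((1 + q ^ (n + 1) - x - q * x * q ^ (n + 1)) * Dq q (m + 1) (n + 1)
          + x * (1 - q ^ (n + 1)) * Dq q (m + 1) n) * hB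
    · linear_combination Dq q⁻¹ (m + 1) (n + 1) * hA
    · linear_combination Dq q (m + 1) (n + 1) * hB

theorem sum_tt {q : F} (h : Gen q) (x : F) (j n : ℕ) :
    ∑ i ∈ range n, (1 - q ^ (2 * i + 1)) * (q ^ i)⁻¹ * tt q x (q ^ i) j =
      q * (1 - q ^ n) * (q ^ j - q ^ n) * tt q x (q ^ n) j / (q ^ n * (1 - q ^ (j + 1))) := by
  have h0 := h.1
  have hj := h.2 j
  induction n with
  | zero => simp
  | succ n ih =>
    rw [Finset.sum_range_succ, ih]
    have hy : q ^ n ≠ 0 := pow_ne_zero n h0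
    have s := tt_shift h x hy j
    rw [pow_succ' q n]
    have e : q * (1 - q * q ^ n) * (q ^ j - q * q ^ n) * tt q x (q * q ^ n) j =
      q * (1 - q * q ^ n) * (tt q x (q ^ n) j * (1 - q ^ n * q ^ (j + 1))) := by
      rw [← s]; ring
    rw [e]
    have e3 : q ^ (2 * n + 1) = q * (q ^ n) ^ 2 := by ring
    rw [e3]
    generalize tt q x (q ^ n) j = T
    have e4 : q ^ (j + 1) = q * q ^ j := by ring
    rw [e4] at hj ⊢
    generalize q ^ n = y at *
    generalize q ^ j = p at *
    field_simp
    ring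

/-- Laurent polynomials with natural coefficients -/
noncomputable def SS (q : F) : Submodule ℕ F := Submodule.span ℕ (Set.range fun i : ℤ => q ^ i)

theorem SS_zpow (q : F) (i : ℤ) : q ^ i ∈ SS q := Submodule.subset_span ⟨i, rfl⟩

theorem SS_pow (q : F) (i : ℕ) : q ^ i ∈ SS q := by
  simpa using SS_zpow q i

theorem SS_one (q : F) : (1 : F) ∈ SS q := by simpa using SS_pow q 0

theorem SS_mul {q : F} (h : q ≠ 0) {a b : F} (ha : a ∈ SS q) (hb : b ∈ SS q) : a * b ∈ SS q := by
  have := Submodule.mul_mem_mul ha hb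
  unfold SS at this ⊢
  rw [Submodule.span_mul_span] at this
  refine Submodule.span_mono ?_ this
  rintro _ ⟨_, ⟨i, rfl⟩, _, ⟨j, rfl⟩, rfl⟩
  exact ⟨i + j, zpow_add₀ h i j⟩

theorem SS_qBin {q : F} (h : Gen q) (n k : ℕ) : qBin q n k ∈ SS q := by
  induction n generalizing k with
  | zero =>
    rcases k with _ | k
    · rw [qBin_zero h]; exact SS_one q
    · rw [qBin_lt q 0 (k + 1) (by omega)]; exact zero_mem _
  | succ n ih =>
    rcases k with _ | k
    · rw [qBin_zero h]; exact SS_one q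
    · rw [qBin_pascal h]
      exact add_mem (ih k) (SS_mul h.1 (SS_pow q _) (ih _))

theorem SS_geom {q : F} (h : Gen q) (k : ℕ) : ∃ z ∈ SS q, 1 - q ^ k = (1 - q) * z := by
  induction k with
  | zero => exact ⟨0, zero_mem _, by simp⟩
  | succ k ih =>
    obtain ⟨z, hz, e⟩ := ih
    exact ⟨z + q ^ k, add_mem hz (SS_pow q k), by rw [mul_add, ← e]; ring⟩

noncomputable def pp (q : F) : ℕ → F
  | 0 => 1
  | k + 1 => pp q k * ((1 + q ^ k) * (1 + q ^ (k + 1)))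

theorem SS_pp {q : F} (h : Gen q) (k : ℕ) : ∃ z ∈ SS q, pp q (k + 1) = (1 + q) * z := by
  induction k with
  | zero => exact ⟨1 + 1, add_mem (SS_one q) (SS_one q), by simp [pp]; ring⟩
  | succ k ih =>
    obtain ⟨z, hz, e⟩ := ih
    refine ⟨z * ((1 + q ^ (k + 1)) * (1 + q ^ (k + 1 + 1))), SS_mul h.1 hz (SS_mul h.1
      (add_mem (SS_one q) (SS_pow q _)) (add_mem (SS_one q) (SS_pow q _))), ?_⟩
    rw [pp, e]; ring

noncomputable def bt (q x : F) : ℕ → F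
  | 0 => 1
  | j + 1 => bt q x j * ((q ^ j - x) * (1 - x * q ^ (j + 1)) /
      (q ^ j * (1 - q ^ (2 * j + 1)) * ((1 - q ^ (j + 1)) * (1 + q ^ (j + 1)))))

theorem one_add_ne {q : F} (h : Gen q) (j : ℕ) : 1 + q ^ (j + 1) ≠ 0 := by
  intro h1
  apply h.2 (2 * j + 1)
  have : 1 - q ^ (2 * j + 1 + 1) = (1 - q ^ (j + 1)) * (1 + q ^ (j + 1)) := by ring
  rw [this, h1, mul_zero]

theorem bt_qBin {q : F} (h : Gen q) (m j : ℕ) : bt q (q ^ m) j = qBin q (m + j) (2 * j) := by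
  have h0 := h.1
  induction j with
  | zero => simp [bt, qBin_zero h]
  | succ j ih =>
    have h1 := qBin_diag h (m + j) (2 * j + 1)
    have h2 := qBin_right h (m + j) (2 * j)
    rw [bt, ih]
    have e : qBin q (m + (j + 1)) (2 * (j + 1)) = qBin q (m + j + 1) (2 * j + 1 + 1) := rfl
    rw [e]
    have d1 := h.2 (2 * j)
    have d2 := h.2 j
    have d3 := one_add_ne h j
    have d4 : q ^ j ≠ 0 := pow_ne_zero j h0
    have f1 : 1 - q ^ (2 * j + 1 + 1) = (1 - q ^ (j + 1)) * (1 + q ^ (j + 1)) := by ring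
    rw [f1] at h1
    have f2 : q ^ (2 * j) = q ^ j * q ^ j := by ring
    rw [f2, pow_add q m j] at h2
    generalize qBin q (m + j + 1) (2 * j + 1 + 1) = A at *
    generalize qBin q (m + j) (2 * j + 1) = B at *
    generalize qBin q (m + j) (2 * j) = C at *
    have h3 : q ^ j * (1 - q ^ (2 * j + 1)) * B = (q ^ j - q ^ m) * C := by
      apply mul_left_cancel₀ d4
      linear_combination h2
    rw [← mul_div_assoc, div_eq_iff (by
      exact mul_ne_zero (mul_ne_zero d4 d1) (mul_ne_zero d2 d3))]
    linear_combination (-(1 - q ^ m * q ^ (j + 1))) * h3 - q ^ j * (1 - q ^ (2 * j + 1)) * h1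

theorem tt_final {q : F} (h : Gen q) {x : F} (hx : x ≠ 0) (v j : ℕ) :
    tt q x (q ^ (v + 1)) j * (q ^ j - q ^ (v + 1)) =
      (1 - q ^ (v + 1)) * (q ^ (j * j + j) / (x ^ j * (q ^ (v + 1)) ^ j)) * bt q x j * pp q j *
        qBin q (v + 1 + j) j * qBin q v j := by
  have h0 := h.1
  induction j with
  | zero => simp [tt_zero, bt, pp, qBin_zero h]
  | succ j ih =>
    have h1 := qBin_diag h (v + 1 + j) j
    have h2 := qBin_right h v j
    have d1 := h.2 (2 * j)
    have d2 := h.2 j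
    have d3 := one_add_ne h j
    have d4 : q ^ j ≠ 0 := pow_ne_zero j h0
    have dy : q ^ v ≠ 0 := pow_ne_zero v h0
    have g1 : qBin q (v + 1 + (j + 1)) (j + 1) =
        (1 - q ^ (v + 1 + j + 1)) * qBin q (v + 1 + j) j / (1 - q ^ (j + 1)) := by
      rw [eq_div_iff d2, ← h1]; rw [mul_comm]; rfl
    have g2 : qBin q v (j + 1) =
        (q ^ j - q ^ v) * qBin q v j / (q ^ j * (1 - q ^ (j + 1))) := by
      rw [eq_div_iff (mul_ne_zero d4 d2), ← h2, mul_comm]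
    have g3 : q ^ ((j + 1) * (j + 1) + (j + 1)) / (x ^ (j + 1) * (q ^ (v + 1)) ^ (j + 1)) =
        q ^ (j * j + j) / (x ^ j * (q ^ (v + 1)) ^ j) * (q ^ j * q ^ j * q / (x * q ^ v)) := by
      field_simp
      ring
    rw [g1, g2, g3, tt_succ]
    simp only [bt, pp]
    have e : tt q x (q ^ (v + 1)) j * kk q x j *
        ((q ^ j - q ^ (v + 1)) * (1 - q ^ (v + 1) * q ^ (j + 1)) / q ^ (v + 1)) *
        (q ^ (j + 1) - q ^ (v + 1)) = (tt q x (q ^ (v + 1)) j * (q ^ j - q ^ (v + 1))) * (kk q x j *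
        ((1 - q ^ (v + 1) * q ^ (j + 1)) / q ^ (v + 1)) * (q ^ (j + 1) - q ^ (v + 1))) := by
      ring
    rw [e, ih]
    unfold kk
    generalize bt q x j = B
    generalize pp q j = P
    generalize qBin q (v + 1 + j) j = Q1
    generalize qBin q v j = Q2
    generalize q ^ (j * j + j) / (x ^ j * (q ^ (v + 1)) ^ j) = W
    have e4 : q ^ (j + 1) = q * q ^ j := by ring
    have e5 : q ^ (v + 1) = q * q ^ v := by ring
    have e6 : q ^ (v + 1 + j + 1) = q * q * q ^ v * q ^ j := by ring
    have e7 : q ^ (2 * j + 1) = q * (q ^ j) ^ 2 := by ring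
    rw [e4] at d2 d3
    rw [e7] at d1
    rw [e6, e5, e4, e7]
    clear ih e h1 h2 g1 g2 g3
    generalize q ^ j = p at *
    generalize q ^ v = y at *
    have core : (q * (p - x) * (1 - x * (q * p)) * (1 + p) /
        (x * (1 - q * p) ^ 3 * (1 - q * p ^ 2)) * ((1 - q * y * (q * p)) / (q * y)) *
          (q * p - q * y)) = (p * p * q / (x * y)) * ((p - x) * (1 - x * (q * p)) /
          (p * (1 - q * p ^ 2) * ((1 - q * p) * (1 + q * p)))) * ((1 + p) * (1 + q * p)) *
          ((1 - q * q * y * p) / (1 - q * p)) * ((p - y) / (p * (1 - q * p))) := by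
      have e9 : q * p - q * y = q * (p - y) := by ring
      have e10 : 1 - q * q * y * p = 1 - q * y * (q * p) := by ring
      rw [e9, e10]
      generalize 1 - q * y * (q * p) = U
      generalize p - y = V
      generalize 1 - x * (q * p) = V2
      generalize p - x = V3
      generalize 1 - q * p = U2 at *
      generalize 1 - q * p ^ 2 = U3 at *
      generalize 1 + q * p = U4 at *
      field_simp
    linear_combination ((1 - q * y) * W * B * P * Q1 * Q2) * core

theorem bt_id {q : F} (h : Gen q) (x : F) (j : ℕ) :
    bt q x j * ((1 - x) * (1 - q * x)) = (1 - q ^ (j + 1)) *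
      ((1 - q ^ (2 * j + 1)) * (1 + q ^ (j + 1)) * bt q x (j + 1)
        + x / q ^ j * (1 - q ^ j) * bt q x j) := by
  have h0 := h.1
  have d1 := h.2 (2 * j)
  have d2 := h.2 j
  have d3 := one_add_ne h j
  have d4 : q ^ j ≠ 0 := pow_ne_zero j h0
  rw [bt]
  field_simp
  ring

theorem SS_term {q : F} (h : Gen q) (m v j : ℕ) :
    (1 - q ^ m) * (1 - q ^ (m + 1)) / ((1 - q ^ 2) * (1 - q ^ (v + 1)) ^ 2) *
      (q * (1 - q ^ (v + 1)) * (q ^ j - q ^ (v + 1)) * tt q (q ^ m) (q ^ (v + 1)) j /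
        (q ^ (v + 1) * (1 - q ^ (j + 1)))) ∈ SS q := by
  have h0 := h.1
  have hx : q ^ m ≠ 0 := pow_ne_zero _ h0
  have hy : q ^ (v + 1) ≠ 0 := pow_ne_zero _ h0
  have d0 := h.2 0
  have d1 := h.2 1
  have d2 := h.2 j
  have d3 := h.2 v
  simp only [zero_add, pow_one, one_add_one_eq_two] at d0 d1
  have key : ∃ z ∈ SS q, pp q j * ((1 - q ^ (2 * j + 1)) * (1 + q ^ (j + 1)) * bt q (q ^ m) (j + 1)
        + q ^ m / q ^ j * (1 - q ^ j) * bt q (q ^ m) j) = (1 - q ^ 2) * z := by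
    have hb : ∀ j, bt q (q ^ m) j ∈ SS q := fun j => by rw [bt_qBin h]; exact SS_qBin h _ _
    rcases j with _ | i
    · exact ⟨_, hb 1, by
        simp only [pp, Nat.mul_zero, zero_add, pow_one, pow_zero, sub_self]; ring⟩
    · obtain ⟨z, hz, e⟩ := SS_pp h i
      obtain ⟨z1, hz1, e1⟩ := SS_geom h (2 * (i + 1) + 1)
      obtain ⟨z2, hz2, e2⟩ := SS_geom h (i + 1)
      have e3 : q ^ m / q ^ (i + 1) = q ^ ((m : ℤ) - (i + 1 : ℕ)) := by
        rw [zpow_sub₀ h0, zpow_natCast, zpow_natCast]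
      refine ⟨z * (z1 * (1 + q ^ (i + 1 + 1)) * bt q (q ^ m) (i + 1 + 1) +
        q ^ ((m : ℤ) - (i + 1 : ℕ)) * z2 * bt q (q ^ m) (i + 1)), ?_, ?_⟩
      · exact SS_mul h0 hz (add_mem (SS_mul h0 (SS_mul h0 hz1 (add_mem (SS_one q) (SS_pow q _)))
          (hb _)) (SS_mul h0 (SS_mul h0 (SS_zpow q _) hz2) (hb _)))
      · rw [e, e1, e2, e3]; ring
  obtain ⟨z, hz, e⟩ := key
  have hw : q * (q ^ (j * j + j) / ((q ^ m) ^ j * (q ^ (v + 1)) ^ j)) / q ^ (v + 1) =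
      q ^ ((1 : ℤ) + (j * j + j : ℕ) - (m * j + (v + 1) * j + (v + 1) : ℕ)) := by
    rw [zpow_sub₀ h0, zpow_add₀ h0, zpow_natCast, zpow_natCast, zpow_one]
    rw [pow_add q (m * j + (v + 1) * j), pow_add q (m * j), pow_mul, pow_mul]
    field_simp
  have hT := tt_final h hx v j
  have hI := bt_id h (q ^ m) j
  have fin : (1 - q ^ m) * (1 - q ^ (m + 1)) / ((1 - q ^ 2) * (1 - q ^ (v + 1)) ^ 2) *
      (q * (1 - q ^ (v + 1)) * (q ^ j - q ^ (v + 1)) * tt q (q ^ m) (q ^ (v + 1)) j /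
        (q ^ (v + 1) * (1 - q ^ (j + 1)))) =
      q * (q ^ (j * j + j) / ((q ^ m) ^ j * (q ^ (v + 1)) ^ j)) / q ^ (v + 1) *
        (qBin q (v + 1 + j) j * qBin q v j) * z := by
    generalize q ^ (j * j + j) / ((q ^ m) ^ j * (q ^ (v + 1)) ^ j) = W at *
    have e8 : q ^ (m + 1) = q * q ^ m := by ring
    rw [e8]
    generalize tt q (q ^ m) (q ^ (v + 1)) j = T at *
    generalize qBin q (v + 1 + j) j = Q1 at *
    generalize qBin q v j = Q2 at *
    generalize ((1 - q ^ (2 * j + 1)) * (1 + q ^ (j + 1)) * bt q (q ^ m) (j + 1)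
        + q ^ m / q ^ j * (1 - q ^ j) * bt q (q ^ m) j) = K at *
    generalize bt q (q ^ m) j = B at *
    generalize pp q j = P at *
    generalize q ^ (v + 1) = y at *
    generalize q ^ m = x at *
    generalize 1 - q ^ (j + 1) = D at *
    generalize q ^ j = p at *
    generalize 1 - q ^ 2 = D2 at *
    have d3' : 1 - y ≠ 0 := d3
    field_simp
    linear_combination (1 - x) * (1 - q * x) * hT + (1 - y) * W * P * Q1 * Q2 * hI
      + D * (1 - y) * W * Q1 * Q2 * e
  rw [fin, hw]
  exact SS_mul h0 (SS_mul h0 (SS_zpow q _) (SS_mul h0 (SS_qBin h _ _) (SS_qBin h _ _))) hz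

end product

theorem Gen_q : Gen q := by
  have hinj : Function.Injective (algebraMap (Polynomial ℚ) Fq) := IsFractionRing.injective _ _
  refine ⟨?_, fun k hk => ?_⟩
  · unfold q
    rw [Ne, map_eq_zero_iff _ hinj]
    exact Polynomial.X_ne_zero
  · unfold q at hk
    rw [← map_pow, ← map_one (algebraMap (Polynomial ℚ) Fq), ← map_sub,
      map_eq_zero_iff _ hinj] at hk
    have := congrArg (Polynomial.eval 0) hk
    simp at this

theorem Dq_sum_nonneg_coeffs (m n : ℕ) (hm : 0 < m) (hn : 0 < n) :
    ∃ f : ℤ →₀ ℕ,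
      ∑ k ∈ Finset.range n,
          (1 - q ^ m) * (1 - q ^ (m + 1)) * (1 - q ^ (2 * k + 1)) /
              ((1 - q ^ 2) * (1 - q ^ n) ^ 2) *
            Dq q m k * Dq q⁻¹ m k * (q ^ k)⁻¹ =
      f.sum fun i b => (b : Fq) * q ^ i := by
  have h := Gen_q
  obtain ⟨M, rfl⟩ : ∃ M, m = M + 1 := ⟨m - 1, by omega⟩
  obtain ⟨v, rfl⟩ : ∃ v, n = v + 1 := ⟨n - 1, by omega⟩
  have key : ∑ k ∈ Finset.range (v + 1),
          (1 - q ^ (M + 1)) * (1 - q ^ (M + 1 + 1)) * (1 - q ^ (2 * k + 1)) /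
              ((1 - q ^ 2) * (1 - q ^ (v + 1)) ^ 2) *
            Dq q (M + 1) k * Dq q⁻¹ (M + 1) k * (q ^ k)⁻¹ ∈ SS q := by
    have e : ∀ k ∈ Finset.range (v + 1),
        (1 - q ^ (M + 1)) * (1 - q ^ (M + 1 + 1)) * (1 - q ^ (2 * k + 1)) /
              ((1 - q ^ 2) * (1 - q ^ (v + 1)) ^ 2) *
            Dq q (M + 1) k * Dq q⁻¹ (M + 1) k * (q ^ k)⁻¹ =
        ∑ j ∈ Finset.range (v + 2), (1 - q ^ (M + 1)) * (1 - q ^ (M + 1 + 1)) /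
          ((1 - q ^ 2) * (1 - q ^ (v + 1)) ^ 2) *
          ((1 - q ^ (2 * k + 1)) * (q ^ k)⁻¹ * tt q (q ^ (M + 1)) (q ^ k) j) := by
      intro k hk
      have hk' : k < v + 1 := by simpa using hk
      rw [← Finset.mul_sum, ← Finset.mul_sum,
        ← (product_formula h M k (v + 2) (by omega)).1]
      ring
    rw [Finset.sum_congr rfl e, Finset.sum_comm]
    refine sum_mem fun j _ => ?_
    rw [← Finset.mul_sum, sum_tt h]
    exact SS_term h (M + 1) v j
  unfold SS at key
  rw [Finsupp.mem_span_range_iff_exists_finsupp] at key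
  obtain ⟨f, hf⟩ := key
  refine ⟨f, ?_⟩
  rw [← hf]
  refine Finsupp.sum_congr fun i _ => ?_
  rw [nsmul_eq_mul]
end
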